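/- arXiv:math/9712202 — 5 statements merged into one kernel-verified Lean document; each statement's English description precedes it below -/
import Mathlib

section
/- Let x, y, n be nonnegative integers with x + y ≥ 1. Then E(x,y;n) = [∏_{i=0}^{n−1} i! · (x+y+i−1)! · (2x+y+2i+1)_i · (x+2y+2i+1)_i / ((x+2i+1)! · (y+2i+1)!)] · ∑_{k=0}^{n} (−1)^k C(n,k) · (x)_k · (y)_{n−k}. (Theorem 8) -/
open Finset

/-- The Pochhammer symbol `(a)_k = a(a+1)⋯(a+k-1)`. -/
noncomputable def poch (a : ℚ) (k : ℕ) : ℚ := ∏ i ∈ Finset.range k, (a + i)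

/-- `rfac k = k!` for `k ≥ 0`, and `0` for negative `k`. -/
noncomputable def rfac (k : ℤ) : ℚ := if 0 ≤ k then (Nat.factorial k.toNat : ℚ) else 0

/-- `rfacInv k = 1/k!` for `k ≥ 0`, and `0` for negative `k`. -/
noncomputable def rfacInv (k : ℤ) : ℚ := if 0 ≤ k then (Nat.factorial k.toNat : ℚ)⁻¹ else 0

/-- The determinant `E(x,y;n)` with `(i,j)`-entry
`(x+y+i+j−1)! (y−x+3j−3i) / ((x+2i−j+1)! (y+2j−i+1)!)`. -/
noncomputable def Edet (x y n : ℕ) : ℚ :=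
  Matrix.det (Matrix.of fun i j : Fin n =>
    rfac ((x : ℤ) + (y : ℤ) + (i : ℕ) + (j : ℕ) - 1) *
      (((y : ℤ) - (x : ℤ) + 3 * ((j : ℕ) : ℤ) - 3 * ((i : ℕ) : ℤ)) : ℚ) *
      rfacInv ((x : ℤ) + 2 * (i : ℕ) - (j : ℕ) + 1) *
      rfacInv ((y : ℤ) + 2 * (j : ℕ) - (i : ℕ) + 1))

/-- The **Jacobi complementary minor formula** for a leading block of size two. -/
theorem det_toBlocks₁₁_adjugate {A ι : Type*} [CommRing A] [Fintype ι] [DecidableEq ι]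
    (M : Matrix (Fin 2 ⊕ ι) (Fin 2 ⊕ ι) A) :
    M.adjugate.toBlocks₁₁.det = M.det * M.toBlocks₂₂.det := by
  let G := Matrix.mvPolynomialX (Fin 2 ⊕ ι) (Fin 2 ⊕ ι) ℤ
  suffices hG : G.adjugate.toBlocks₁₁.det = G.det * G.toBlocks₂₂.det by
    let φ := MvPolynomial.aeval (R := ℤ) fun p : (Fin 2 ⊕ ι) × (Fin 2 ⊕ ι) => M p.1 p.2
    have hM : φ.mapMatrix G = M := Matrix.mvPolynomialX_mapMatrix_aeval ℤ M
    have := congrArg φ hG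
    rw [map_mul, AlgHom.map_det, AlgHom.map_det, AlgHom.map_det, hM] at this
    have h₁ : φ.mapMatrix G.adjugate.toBlocks₁₁ = M.adjugate.toBlocks₁₁ := by
      rw [← hM, ← AlgHom.map_adjugate]; rfl
    have h₂ : φ.mapMatrix G.toBlocks₂₂ = M.toBlocks₂₂ := by
      rw [← hM]; rfl
    rwa [h₁, h₂] at this
  have hdet : G.det ≠ 0 := Matrix.det_mvPolynomialX_ne_zero _ ℤ
  apply mul_left_cancel₀ hdet
  have hprod : G * Matrix.fromBlocks G.adjugate.toBlocks₁₁ 0 G.adjugate.toBlocks₂₁ 1 =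
      Matrix.fromBlocks (G.det • 1) G.toBlocks₁₂ 0 G.toBlocks₂₂ := by
    have h := Matrix.mul_adjugate G
    have hsplit : G * G.adjugate = Matrix.fromBlocks G.toBlocks₁₁ G.toBlocks₁₂ G.toBlocks₂₁
        G.toBlocks₂₂ * Matrix.fromBlocks G.adjugate.toBlocks₁₁ G.adjugate.toBlocks₁₂
        G.adjugate.toBlocks₂₁ G.adjugate.toBlocks₂₂ := by
      simp only [Matrix.fromBlocks_toBlocks]
    rw [hsplit, Matrix.fromBlocks_multiply, ← Matrix.fromBlocks_one, Matrix.fromBlocks_smul,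
      Matrix.fromBlocks_inj] at h
    calc _ = Matrix.fromBlocks G.toBlocks₁₁ G.toBlocks₁₂ G.toBlocks₂₁ G.toBlocks₂₂ *
          Matrix.fromBlocks G.adjugate.toBlocks₁₁ 0 G.adjugate.toBlocks₂₁ 1 := by
          rw [Matrix.fromBlocks_toBlocks]
      _ = _ := by
          rw [Matrix.fromBlocks_multiply]
          simp [h.1, h.2.2.1]
  have := congrArg Matrix.det hprod
  rw [Matrix.det_mul, Matrix.det_fromBlocks_zero₁₂, Matrix.det_fromBlocks_zero₂₁, Matrix.det_one,
    Matrix.det_smul] at this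
  simp at this
  rw [this]; ring

/-- The **Desnanot–Jacobi identity**. -/
theorem desnanot_jacobi {A : Type*} [CommRing A] {k : ℕ}
    (M : Matrix (Fin (k + 2)) (Fin (k + 2)) A) :
    M.det * (M.submatrix (fun i : Fin k => i.succ.castSucc) fun j => j.succ.castSucc).det =
      (M.submatrix Fin.castSucc Fin.castSucc).det * (M.submatrix Fin.succ Fin.succ).det -
        (M.submatrix Fin.succ Fin.castSucc).det * (M.submatrix Fin.castSucc Fin.succ).det := by
  let f : Fin 2 ⊕ Fin k → Fin (k + 2) :=
    Sum.elim ![0, Fin.last (k + 1)] fun i => i.succ.castSucc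
  have hf : Function.Bijective f := by
    rw [Fintype.bijective_iff_injective_and_card]
    refine ⟨?_, by simp [add_comm]⟩
    rintro (i | i) (j | j) h
    · fin_cases i <;> fin_cases j <;> simp [f, Fin.ext_iff] at h ⊢
    · fin_cases i <;> simp [f, Fin.ext_iff] at h; omega
    · fin_cases j <;> simp [f, Fin.ext_iff] at h; omega
    · simpa [f, Fin.ext_iff] using h
  let e := Equiv.ofBijective f hf
  have h := det_toBlocks₁₁_adjugate (M.submatrix e e)
  have h₂₂ : (M.submatrix e e).toBlocks₂₂ =
      M.submatrix (fun i : Fin k => i.succ.castSucc) fun j => j.succ.castSucc := rfl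
  have he₀ : e (Sum.inl 0) = 0 := rfl
  have he₁ : e (Sum.inl 1) = Fin.last (k + 1) := rfl
  rw [Matrix.det_submatrix_equiv_self, Matrix.adjugate_submatrix_equiv_self, h₂₂] at h
  rw [← h, Matrix.det_fin_two]
  simp only [Matrix.toBlocks₁₁, Matrix.of_apply, Matrix.submatrix_apply, he₀, he₁,
    Matrix.adjugate_fin_succ_eq_det_submatrix, Fin.succAbove_zero, Fin.succAbove_last]
  have hs : ((-1 : A) ^ (k + 1)) * (-1) ^ (k + 1) = 1 := by
    rw [← mul_pow]; simp
  simp [pow_add] at hs ⊢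
  linear_combination ((M.submatrix Fin.castSucc Fin.castSucc).det *
    (M.submatrix Fin.succ Fin.succ).det - (M.submatrix Fin.succ Fin.castSucc).det *
      (M.submatrix Fin.castSucc Fin.succ).det) * hs

section
variable {A : Type*} [CommRing A]

/-- The rising factorial `a (a + 1) ⋯ (a + k - 1)` in a commutative ring. -/
def rising (a : A) (k : ℕ) : A := ∏ i ∈ range k, (a + i)

theorem rising_succ (a : A) (k : ℕ) : rising a (k + 1) = rising a k * (a + k) := by
  simp [rising, prod_range_succ]

theorem rising_succ' (a : A) (k : ℕ) : rising a (k + 1) = a * rising (a + 1) k := by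
  simp only [rising, prod_range_succ', Nat.cast_zero, add_zero, Nat.cast_add, Nat.cast_one]
  rw [mul_comm]
  congr 1
  exact prod_congr rfl fun i _ => by ring

theorem map_rising {B : Type*} [CommRing B] (φ : A →+* B) (a : A) (k : ℕ) :
    φ (rising a k) = rising (φ a) k := by
  simp [rising]

/-- `n!` times the coefficient of `t ^ n` in `(1 + t) ^ (-x) * (1 - t) ^ (-y)`, computed through
the derivative of this power series. -/
def altSum : A → A → ℕ → A
  | _, _, 0 => 1
  | x, y, n + 1 => -x * altSum (x + 1) y n + y * altSum x (y + 1) n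

theorem altSum_succ (x y : A) (n : ℕ) :
    altSum x y (n + 1) = -x * altSum (x + 1) y n + y * altSum x (y + 1) n := rfl

theorem map_altSum {B : Type*} [CommRing B] (φ : A →+* B) (n : ℕ) (x y : A) :
    φ (altSum x y n) = altSum (φ x) (φ y) n := by
  induction n generalizing x y with
  | zero => simp [altSum]
  | succ n ih => simp [altSum, ih]

theorem altSum_eq_sum (x y : A) (n : ℕ) :
    altSum x y n =
      ∑ k ∈ range (n + 1), (-1 : A) ^ k * (n.choose k : A) * rising x k * rising y (n - k) := by
  induction n generalizing x y with
  | zero => simp [altSum, rising]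
  | succ n ih =>
    have h := sum_choose_succ_mul (fun i j => (-1 : A) ^ i * rising x i * rising y j) n
    rw [altSum_succ, ih, ih, sum_congr rfl fun k _ => show (-1 : A) ^ k * ((n + 1).choose k : A) *
      rising x k * rising y (n + 1 - k) = ((n + 1).choose k : A) *
        ((-1 : A) ^ k * rising x k * rising y (n + 1 - k)) by ring, h, mul_sum, mul_sum, add_comm]
    congr 1
    · refine sum_congr rfl fun k hk => ?_
      rw [Nat.succ_sub (Nat.lt_succ_iff.mp (mem_range.mp hk)), Nat.succ_eq_add_one, rising_succ']
      ring
    · refine sum_congr rfl fun k _ => ?_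
      rw [rising_succ']
      ring

theorem altSum_lower_right (x y : A) (n : ℕ) :
    altSum x y (n + 1) = altSum x (y + 1) (n + 1) - (n + 1) * altSum x (y + 1) n := by
  induction n generalizing x y with
  | zero => simp [altSum]; ring
  | succ n ih =>
    rw [altSum_succ x y, altSum_succ x (y + 1) (n + 1)]
    push_cast
    linear_combination -x * ih (x + 1) y + (y + 1) * ih x (y + 1) +
      (n + 1) * altSum_succ x (y + 1) n

theorem altSum_lower_left (x y : A) (n : ℕ) :
    altSum x y (n + 1) = altSum (x + 1) y (n + 1) + (n + 1) * altSum (x + 1) y n := by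
  induction n generalizing x y with
  | zero => simp [altSum]; ring
  | succ n ih =>
    rw [altSum_succ x y, altSum_succ (x + 1) y (n + 1)]
    push_cast
    linear_combination y * ih x (y + 1) - (x + 1) * ih (x + 1) y -
      (n + 1) * altSum_succ (x + 1) y n

theorem altSum_raise_add (x y : A) (n : ℕ) :
    x * altSum (x + 1) y n + y * altSum x (y + 1) n = (x + y + n) * altSum x y n := by
  cases n with
  | zero => simp [altSum]
  | succ n =>
    push_cast
    linear_combination -x * altSum_lower_left x y n - y * altSum_lower_right x y n -
      (n + 1) * altSum_succ x y n

theorem altSum_recurrence (x y : A) (n : ℕ) :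
    altSum x y (n + 2) =
      (y - x) * altSum x y (n + 1) + (n + 1) * (x + y + n) * altSum x y n := by
  linear_combination altSum_succ x y (n + 1) + x * altSum_lower_left x y n +
    (-y) * altSum_lower_right x y n + (n + 1) * altSum_raise_add x y n

theorem altSum_add_two (x y : A) (n : ℕ) :
    altSum x y (n + 2) =
      (y - x) * altSum (x + 1) (y + 1) (n + 1) +
        (n + 1) * (x + y) * altSum (x + 1) (y + 1) n := by
  have h₁ := altSum_lower_left x y (n + 1)
  have h₂ := altSum_lower_right (x + 1) y (n + 1)
  have h₃ := altSum_lower_right (x + 1) y n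
  have h₄ := altSum_recurrence (x + 1) (y + 1) n
  push_cast at h₁ h₂
  linear_combination h₁ + h₂ + (n + 2) * h₃ + h₄

theorem altSum_add_one (x y : A) (n : ℕ) :
    (x + y + n + 1) * altSum x y (n + 1) =
      (x + y) * altSum (x + 1) (y + 1) (n + 1) +
        (n + 1) * (y - x) * altSum (x + 1) (y + 1) n := by
  cases n with
  | zero => simp [altSum]; ring
  | succ n =>
    have h₀ := altSum_add_two x y n
    have h₄ := altSum_recurrence (x + 1) (y + 1) n
    push_cast
    linear_combination (x + y + n + 2) * h₀ - (x + y) * h₄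

theorem altSum_shift_left (x y : A) (n : ℕ) :
    (x + 1) * altSum (x + 2) (y - 1) (n + 1) =
      (x + 2 * n + 3) * altSum (x + 1) (y + 1) (n + 1) -
        (n + 1) * (x + 2 * y + 2 * n + 3) * altSum (x + 1) (y + 1) n := by
  have h₀ := altSum_succ (x + 1) (y - 1) (n + 1)
  have h₁ := altSum_lower_right (x + 1) (y - 1) (n + 1)
  have h₂ := altSum_lower_right (x + 1) y (n + 1)
  have h₃ := altSum_lower_right (x + 1) y n
  have h₄ := altSum_recurrence (x + 1) (y + 1) n
  rw [show x + 1 + 1 = x + 2 by ring, sub_add_cancel] at h₀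
  rw [sub_add_cancel] at h₁
  push_cast at h₁ h₂
  linear_combination h₀ - h₁ - h₂ - h₄ + (y - 1 + (n + 2)) * h₃

theorem altSum_shift_right (x y : A) (n : ℕ) :
    (y + 1) * altSum (x - 1) (y + 2) (n + 1) =
      (y + 2 * n + 3) * altSum (x + 1) (y + 1) (n + 1) +
        (n + 1) * (2 * x + y + 2 * n + 3) * altSum (x + 1) (y + 1) n := by
  have h₀ := altSum_succ (x - 1) (y + 1) (n + 1)
  have h₁ := altSum_lower_left (x - 1) (y + 1) (n + 1)
  have h₂ := altSum_lower_left x (y + 1) (n + 1)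
  have h₃ := altSum_lower_left x (y + 1) n
  have h₄ := altSum_recurrence (x + 1) (y + 1) n
  rw [show y + 1 + 1 = y + 2 by ring, sub_add_cancel] at h₀
  rw [sub_add_cancel] at h₁
  push_cast at h₁ h₂
  linear_combination -h₀ + h₁ + h₂ + h₄ + (x - 1 + (n + 2)) * h₃

/-- The quadratic relation between contiguous alternating sums matching the condensation of
`scaledDet`. -/
theorem altSum_quadratic (x y : A) (n : ℕ) :
    (n + 1) * (2 * x + y + 2 * n + 3) * (x + 2 * y + 2 * n + 3) *
        (altSum x y (n + 2) * altSum (x + 1) (y + 1) n) =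
      (x + 2 * n + 3) * (y + 2 * n + 3) * (x + y + n + 1) *
          (altSum x y (n + 1) * altSum (x + 1) (y + 1) (n + 1)) -
        (x + y) * (x + 1) * (y + 1) *
          (altSum (x + 2) (y - 1) (n + 1) * altSum (x - 1) (y + 2) (n + 1)) := by
  have h₁ := altSum_shift_left x y n
  have h₂ := altSum_shift_right x y n
  linear_combination
    (n + 1) * (2 * x + y + 2 * n + 3) * (x + 2 * y + 2 * n + 3) * altSum (x + 1) (y + 1) n *
        altSum_add_two x y n -
      (x + 2 * n + 3) * (y + 2 * n + 3) * altSum (x + 1) (y + 1) (n + 1) * altSum_add_one x y n +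
      (x + y) * ((y + 1) * altSum (x - 1) (y + 2) (n + 1)) * h₁ +
      (x + y) * ((x + 2 * n + 3) * altSum (x + 1) (y + 1) (n + 1) -
        (n + 1) * (x + 2 * y + 2 * n + 3) * altSum (x + 1) (y + 1) n) * h₂

/-- The matrix entries of `Edet x y`, with row and column denominators cleared and divided by
`(x + y - 1)!`. -/
def scaledEntry (x y : A) (i j : ℕ) : A :=
  rising (x + y) (i + j) * (y - x + 3 * j - 3 * i) * rising (x + 2 * i - j + 2) j *
    rising (y + 2 * j - i + 2) i

theorem scaledEntry_succ_left (x y : A) (i j : ℕ) :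
    scaledEntry x y (i + 1) j =
      (x + y) * (y + 2 * j + 1) * scaledEntry (x + 2) (y - 1) i j := by
  have h₁ : rising (x + y) (i + 1 + j) = (x + y) * rising (x + 2 + (y - 1)) (i + j) := by
    rw [add_right_comm i 1 j, rising_succ']
    congr 2; ring
  have h₂ : rising (y + 2 * j - (i + 1 : ℕ) + 2) (i + 1) =
      rising (y - 1 + 2 * j - i + 2) i * (y + 2 * j + 1) := by
    rw [rising_succ]
    push_cast
    congr 1
    · congr 1; ring
    · ring
  have h₃ : x + 2 * (i + 1 : ℕ) - j + 2 = x + 2 + 2 * i - j + 2 := by push_cast; ring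
  rw [scaledEntry, scaledEntry, h₁, h₂, h₃]
  push_cast
  ring

theorem scaledEntry_swap (x y : A) (i j : ℕ) :
    scaledEntry y x j i = -scaledEntry x y i j := by
  rw [scaledEntry, scaledEntry, add_comm y x, add_comm j i]
  ring

theorem scaledEntry_succ_right (x y : A) (i j : ℕ) :
    scaledEntry x y i (j + 1) =
      (x + y) * (x + 2 * i + 1) * scaledEntry (x - 1) (y + 2) i j := by
  rw [scaledEntry_swap y x, scaledEntry_succ_left, scaledEntry_swap (x - 1)]
  ring

theorem scaledEntry_succ_succ (x y : A) (i j : ℕ) :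
    scaledEntry x y (i + 1) (j + 1) =
      (x + y) * (x + y + 1) * (x + 2 * i + 3) * (y + 2 * j + 3) *
        scaledEntry (x + 1) (y + 1) i j := by
  rw [scaledEntry_succ_left, scaledEntry_succ_right,
    show x + 2 - 1 = x + 1 by ring, show y - 1 + 2 = y + 1 by ring]
  push_cast
  ring

/-- The determinant of the matrix with entries `scaledEntry x y i j`. -/
def scaledDet (x y : A) (n : ℕ) : A :=
  (Matrix.of fun i j : Fin n => scaledEntry x y i j).det

theorem map_scaledDet {B : Type*} [CommRing B] (φ : A →+* B) (x y : A) (n : ℕ) :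
    φ (scaledDet x y n) = scaledDet (φ x) (φ y) n := by
  rw [scaledDet, RingHom.map_det]
  congr 1
  ext i j
  simp [scaledEntry, map_rising, map_ofNat φ]

theorem det_of_mul_mul {n : ℕ} (u v : ℕ → A) (M : ℕ → ℕ → A) :
    (Matrix.of fun i j : Fin n => u i * v j * M i j).det =
      (∏ i ∈ range n, u i * v i) * (Matrix.of fun i j : Fin n => M i j).det := by
  have h₁ := Matrix.det_mul_column (fun i : Fin n => u i)
    (Matrix.of fun i j : Fin n => v j * M i j)
  have h₂ := Matrix.det_mul_row (fun j : Fin n => v j) (Matrix.of fun i j : Fin n => M i j)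
  simp only [Matrix.of_apply] at h₁ h₂
  rw [h₂, Fin.prod_univ_eq_prod_range (fun i => u i), Fin.prod_univ_eq_prod_range (fun i => v i),
    ← mul_assoc, ← prod_mul_distrib] at h₁
  simpa only [mul_assoc] using h₁

theorem scaledDet_condensation (x y : A) (n : ℕ) :
    scaledDet x y (n + 2) *
        ((∏ i ∈ range n, (x + y) * (x + y + 1) * (x + 2 * i + 3) * (y + 2 * i + 3)) *
          scaledDet (x + 1) (y + 1) n) =
      scaledDet x y (n + 1) *
          ((∏ i ∈ range (n + 1), (x + y) * (x + y + 1) * (x + 2 * i + 3) * (y + 2 * i + 3)) *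
            scaledDet (x + 1) (y + 1) (n + 1)) -
        (∏ i ∈ range (n + 1), (x + y) ^ 2 * (x + 2 * i + 1) * (y + 2 * i + 1)) *
          (scaledDet (x + 2) (y - 1) (n + 1) * scaledDet (x - 1) (y + 2) (n + 1)) := by
  have hmid (m : ℕ) : (Matrix.of fun i j : Fin m => scaledEntry x y (i + 1) (j + 1)).det =
      (∏ i ∈ range m, (x + y) * (x + y + 1) * (x + 2 * i + 3) * (y + 2 * i + 3)) *
        scaledDet (x + 1) (y + 1) m := by
    simp only [scaledEntry_succ_succ]
    exact det_of_mul_mul (fun i => (x + y) * (x + y + 1) * (x + 2 * i + 3))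
      (fun j => y + 2 * j + 3) _
  have hleft : (Matrix.of fun i j : Fin (n + 1) => scaledEntry x y (i + 1) j).det =
      (∏ i ∈ range (n + 1), (x + y) * (y + 2 * i + 1)) * scaledDet (x + 2) (y - 1) (n + 1) := by
    simp only [scaledEntry_succ_left]
    exact det_of_mul_mul (fun _ => x + y) (fun j => y + 2 * j + 1) _
  have hright : (Matrix.of fun i j : Fin (n + 1) => scaledEntry x y i (j + 1)).det =
      (∏ i ∈ range (n + 1), (x + y) * (x + 2 * i + 1) * 1) *
        scaledDet (x - 1) (y + 2) (n + 1) := by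
    simp only [scaledEntry_succ_right]
    rw [scaledDet, ← det_of_mul_mul (fun i => (x + y) * (x + 2 * i + 1)) (fun _ => 1)]
    simp only [mul_one]
  have hprod : (∏ i ∈ range (n + 1), (x + y) ^ 2 * (x + 2 * i + 1) * (y + 2 * i + 1)) =
      (∏ i ∈ range (n + 1), (x + y) * (y + 2 * i + 1)) *
        ∏ i ∈ range (n + 1), (x + y) * (x + 2 * i + 1) * 1 := by
    rw [← prod_mul_distrib]
    exact prod_congr rfl fun i _ => by ring
  rw [hprod, mul_mul_mul_comm, ← hmid, ← hmid, ← hleft, ← hright, scaledDet, scaledDet]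
  have h := desnanot_jacobi (Matrix.of fun i j : Fin (n + 2) => scaledEntry x y i j)
  simpa only [Matrix.submatrix, Matrix.of_apply, Fin.val_succ, Fin.val_castSucc] using h

/-- The `i`-th factor of the product formula for `scaledDet`. -/
def detFactor (x y : A) (i : ℕ) : A :=
  (i.factorial : A) * rising (x + y) i * rising (2 * x + y + 2 * i + 1) i *
    rising (x + 2 * y + 2 * i + 1) i

theorem map_detFactor {B : Type*} [CommRing B] (φ : A →+* B) (x y : A) (i : ℕ) :
    φ (detFactor x y i) = detFactor (φ x) (φ y) i := by
  simp [detFactor, map_rising, map_ofNat φ]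

/-- The factor shared by `detFactor x y (n + 1)` and `detFactor (x + 1) (y + 1) n`. -/
def commonFactor (x y : A) (n : ℕ) : A :=
  (n.factorial : A) * rising (x + y) (n + 1) * rising (2 * x + y + 2 * n + 4) n *
    rising (x + 2 * y + 2 * n + 4) n

theorem detFactor_succ (x y : A) (n : ℕ) :
    detFactor x y (n + 1) =
      (n + 1) * (2 * x + y + 2 * n + 3) * (x + 2 * y + 2 * n + 3) * commonFactor x y n := by
  have h₁ : rising (2 * x + y + 2 * (n + 1 : ℕ) + 1) (n + 1) =
      (2 * x + y + 2 * n + 3) * rising (2 * x + y + 2 * n + 4) n := by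
    rw [rising_succ']
    push_cast
    congr 1
    · ring
    · congr 1; ring
  have h₂ : rising (x + 2 * y + 2 * (n + 1 : ℕ) + 1) (n + 1) =
      (x + 2 * y + 2 * n + 3) * rising (x + 2 * y + 2 * n + 4) n := by
    rw [rising_succ']
    push_cast
    congr 1
    · ring
    · congr 1; ring
  rw [detFactor, commonFactor, h₁, h₂, Nat.factorial_succ]
  push_cast
  ring

theorem detFactor_shift_shift (x y : A) (n : ℕ) :
    (x + y) * (x + y + 1) * detFactor (x + 1) (y + 1) n =
      (x + y + n + 1) * commonFactor x y n := by
  have h : (x + y) * (x + y + 1) * rising (x + 1 + (y + 1)) n =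
      rising (x + y) (n + 1) * (x + y + n + 1) := by
    have h₁ := rising_succ (x + y) (n + 1)
    rw [rising_succ', rising_succ'] at h₁
    push_cast at h₁
    rw [show x + 1 + (y + 1) = x + y + 1 + 1 by ring]
    linear_combination h₁
  rw [detFactor, commonFactor,
    show 2 * (x + 1) + (y + 1) + 2 * (n : A) + 1 = 2 * x + y + 2 * n + 4 by ring,
    show x + 1 + 2 * (y + 1) + 2 * (n : A) + 1 = x + 2 * y + 2 * n + 4 by ring]
  linear_combination (n.factorial : A) * rising (2 * x + y + 2 * n + 4) n *
    rising (x + 2 * y + 2 * n + 4) n * h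

theorem detFactor_shift_mul (x y : A) (n : ℕ) :
    (x + y) ^ 2 * (detFactor (x + 2) (y - 1) (n + 1) * detFactor (x - 1) (y + 2) (n + 1)) =
      (x + y + n + 1) * (detFactor x y (n + 1) * commonFactor x y (n + 1)) := by
  have h₁ := rising_succ' (x + y) (n + 1)
  have h₂ := rising_succ (x + y) (n + 1)
  push_cast at h₂
  rw [detFactor, detFactor, detFactor, commonFactor,
    show x + 2 + (y - 1) = x + y + 1 by ring, show x - 1 + (y + 2) = x + y + 1 by ring]
  push_cast
  rw [show 2 * (x + 2) + (y - 1) + 2 * ((n : A) + 1) + 1 = 2 * x + y + 2 * (n + 1) + 4 by ring,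
    show x + 2 + 2 * (y - 1) + 2 * ((n : A) + 1) + 1 = x + 2 * y + 2 * (n + 1) + 1 by ring,
    show 2 * (x - 1) + (y + 2) + 2 * ((n : A) + 1) + 1 = 2 * x + y + 2 * (n + 1) + 1 by ring,
    show x - 1 + 2 * (y + 2) + 2 * ((n : A) + 1) + 1 = x + 2 * y + 2 * (n + 1) + 4 by ring]
  have h : (x + y) ^ 2 * (rising (x + y + 1) (n + 1) * rising (x + y + 1) (n + 1)) =
      (x + y + n + 1) * (rising (x + y) (n + 1) * rising (x + y) (n + 1 + 1)) := by
    linear_combination -((x + y) * rising (x + y + 1) (n + 1)) * h₁ +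
      rising (x + y) (n + 1 + 1) * (h₂ - h₁)
  generalize rising (2 * x + y + 2 * ((n : A) + 1) + 4) (n + 1) = a
  generalize rising (x + 2 * y + 2 * ((n : A) + 1) + 4) (n + 1) = b
  generalize rising (2 * x + y + 2 * ((n : A) + 1) + 1) (n + 1) = c
  generalize rising (x + 2 * y + 2 * ((n : A) + 1) + 1) (n + 1) = d
  linear_combination ((n + 1).factorial : A) ^ 2 * a * b * c * d * h

theorem prod_detFactor_shift_mul (x y : A) (n : ℕ) :
    (∏ i ∈ range (n + 1), (x + y) ^ 2 * (x + 2 * i + 1) * (y + 2 * i + 1)) *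
        ((∏ i ∈ range (n + 1), detFactor (x + 2) (y - 1) i) *
          ∏ i ∈ range (n + 1), detFactor (x - 1) (y + 2) i) =
      (x + y) * (x + 1) * (y + 1) * ((∏ i ∈ range (n + 1), detFactor x y i) *
        (∏ i ∈ range n, detFactor (x + 1) (y + 1) i) *
        (∏ i ∈ range n, (x + y) * (x + y + 1) * (x + 2 * i + 3) * (y + 2 * i + 3)) *
        commonFactor x y n) := by
  induction n with
  | zero => simp [detFactor, commonFactor, rising]; ring
  | succ n ih =>
    have h₁ := detFactor_shift_mul x y n
    have h₂ := detFactor_shift_shift x y n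
    rw [prod_range_succ _ (n + 1), prod_range_succ (detFactor (x + 2) (y - 1)) (n + 1),
      prod_range_succ (detFactor (x - 1) (y + 2)) (n + 1),
      prod_range_succ (detFactor x y) (n + 1), prod_range_succ (detFactor (x + 1) (y + 1)) n,
      prod_range_succ (fun i : ℕ => (x + y) * (x + y + 1) * (x + 2 * i + 3) * (y + 2 * i + 3)) n]
    generalize ∏ i ∈ range (n + 1), (x + y) ^ 2 * (x + 2 * i + 1) * (y + 2 * i + 1) = c at *
    generalize ∏ i ∈ range n, (x + y) * (x + y + 1) * (x + 2 * i + 3) * (y + 2 * i + 3) = b at *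
    generalize ∏ i ∈ range (n + 1), detFactor x y i = q₀ at *
    generalize ∏ i ∈ range n, detFactor (x + 1) (y + 1) i = q₁ at *
    push_cast
    linear_combination (x + y) ^ 2 * (x + 2 * n + 3) * (y + 2 * n + 3) *
        detFactor (x + 2) (y - 1) (n + 1) * detFactor (x - 1) (y + 2) (n + 1) * ih +
      (x + y) * (x + 1) * (y + 1) * (q₀ * q₁ * b * commonFactor x y n) * (x + 2 * n + 3) *
        (y + 2 * n + 3) * h₁ -
      (x + y) * (x + 1) * (y + 1) * q₀ * q₁ * b * detFactor x y (n + 1) *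
        commonFactor x y (n + 1) * (x + 2 * n + 3) * (y + 2 * n + 3) * h₂

/-- The inductive step from sizes `n` and `n + 1` to size `n + 2`, by condensation. -/
theorem scaledDet_add_two [IsDomain A] (x y : A) (n : ℕ)
    (hne : (∏ i ∈ range n, (x + y) * (x + y + 1) * (x + 2 * i + 3) * (y + 2 * i + 3)) *
      ((∏ i ∈ range n, detFactor (x + 1) (y + 1) i) * altSum (x + 1) (y + 1) n) ≠ 0)
    (h₀ : scaledDet (x + 1) (y + 1) n =
      (∏ i ∈ range n, detFactor (x + 1) (y + 1) i) * altSum (x + 1) (y + 1) n)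
    (h₁ : ∀ a b : A, (a, b) ∈ [(x, y), (x + 1, y + 1), (x + 2, y - 1), (x - 1, y + 2)] →
      scaledDet a b (n + 1) = (∏ i ∈ range (n + 1), detFactor a b i) * altSum a b (n + 1)) :
    scaledDet x y (n + 2) = (∏ i ∈ range (n + 2), detFactor x y i) * altSum x y (n + 2) := by
  apply mul_right_cancel₀ hne
  have h := scaledDet_condensation x y n
  rw [h₀, h₁ x y (by simp), h₁ (x + 1) (y + 1) (by simp), h₁ (x + 2) (y - 1) (by simp),
    h₁ (x - 1) (y + 2) (by simp)] at h
  have hq := altSum_quadratic x y n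
  have hp := prod_detFactor_shift_mul x y n
  have hs := detFactor_shift_shift x y n
  rw [prod_range_succ (detFactor (x + 1) (y + 1)) n,
    prod_range_succ (fun i : ℕ => (x + y) * (x + y + 1) * (x + 2 * i + 3) * (y + 2 * i + 3)) n]
    at h
  rw [h, prod_range_succ _ (n + 1), detFactor_succ]
  generalize ∏ i ∈ range (n + 1), (x + y) ^ 2 * (x + 2 * i + 1) * (y + 2 * i + 1) = c at *
  generalize ∏ i ∈ range n, (x + y) * (x + y + 1) * (x + 2 * i + 3) * (y + 2 * i + 3) = b at *
  generalize ∏ i ∈ range (n + 1), detFactor x y i = q₀ at *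
  generalize ∏ i ∈ range n, detFactor (x + 1) (y + 1) i = q₁ at *
  linear_combination
    q₀ * altSum x y (n + 1) * b * (x + 2 * n + 3) * (y + 2 * n + 3) * q₁ *
        altSum (x + 1) (y + 1) (n + 1) * hs -
      altSum (x + 2) (y - 1) (n + 1) * altSum (x - 1) (y + 2) (n + 1) * hp -
      q₀ * q₁ * b * commonFactor x y n * hq

theorem altSum_zero_left (y : A) (n : ℕ) : altSum 0 y n = rising y n := by
  induction n generalizing y with
  | zero => simp [altSum, rising]
  | succ n ih => rw [altSum_succ, ih, rising_succ']; ring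
end

theorem rising_pos {a : ℚ} (ha : 0 < a) (k : ℕ) : 0 < rising a k :=
  prod_pos fun _ _ => by positivity

open Polynomial in
/-- The evaluation of `scaledDet` along a generic line `x + y = z`. -/
theorem scaledDet_eq_generic (n : ℕ) (z : ℚ) (hz : 0 < z) (x y : ℚ[X]) (hxy : x + y = C z)
    (c : ℚ) (hx : x = X + C c) :
    scaledDet x y n = (∏ i ∈ range n, detFactor x y i) * altSum x y n := by
  induction n using Nat.twoStepInduction generalizing z x y c with
  | zero => simp [scaledDet, altSum]
  | one => simp [scaledDet, scaledEntry, altSum, detFactor, rising]; ring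
  | more n ih₀ ih₁ =>
    apply scaledDet_add_two
    · intro h
      have h := congrArg (evalRingHom (-c - 1)) h
      have hx₀ : evalRingHom (-c - 1) x = -1 := by simp [hx]; ring
      have hy₀ : evalRingHom (-c - 1) y = z + 1 := by
        have := congrArg (evalRingHom (-c - 1)) hxy
        rw [map_add, hx₀] at this
        simp at this ⊢
        linarith
      simp only [map_mul, map_prod, map_add, map_detFactor, map_altSum, map_one, map_natCast,
        map_ofNat, map_zero, hx₀, hy₀, neg_add_cancel, altSum_zero_left] at h
      refine absurd h (ne_of_gt ?_)
      refine mul_pos (prod_pos fun i _ => ?_)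
        (mul_pos (prod_pos fun i _ => ?_) (rising_pos (by linarith) n))
      · rw [show (-1 + (z + 1)) = z by ring, show (-1 + 2 * (i : ℚ) + 3) = 2 * i + 2 by ring]
        positivity
      · have h₁ := rising_pos (a := 0 + (z + 1 + 1)) (by positivity) i
        have h₂ := rising_pos (a := 2 * 0 + (z + 1 + 1) + 2 * i + 1) (by positivity) i
        have h₃ := rising_pos (a := 0 + 2 * (z + 1 + 1) + 2 * i + 1) (by positivity) i
        unfold detFactor
        positivity
    · exact ih₀ (z + 2) (by linarith) _ _ (by rw [C_add, ← hxy, C_ofNat]; ring) (c + 1)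
        (by rw [hx, C_add, C_1]; ring)
    · intro a b hab
      simp only [List.mem_cons, Prod.mk.injEq, List.not_mem_nil, or_false] at hab
      rcases hab with ⟨rfl, rfl⟩ | ⟨rfl, rfl⟩ | ⟨rfl, rfl⟩ | ⟨rfl, rfl⟩
      · exact ih₁ z hz _ _ hxy c hx
      · exact ih₁ (z + 2) (by linarith) _ _ (by rw [C_add, ← hxy, C_ofNat]; ring) (c + 1)
          (by rw [hx, C_add, C_1]; ring)
      · exact ih₁ (z + 1) (by linarith) _ _ (by rw [C_add, ← hxy, C_1]; ring) (c + 2)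
          (by rw [hx, C_add, C_ofNat]; ring)
      · exact ih₁ (z + 1) (by linarith) _ _ (by rw [C_add, ← hxy, C_1]; ring) (c - 1)
          (by rw [hx, C_sub, C_1]; ring)

open Polynomial in
theorem scaledDet_eq (x y : ℚ) (hxy : 0 < x + y) (n : ℕ) :
    scaledDet x y n = (∏ i ∈ range n, detFactor x y i) * altSum x y n := by
  have h := congrArg (evalRingHom x) (scaledDet_eq_generic n (x + y) hxy X (C (x + y) - X)
    (by ring) 0 (by simp))
  simpa only [map_scaledDet, map_mul, map_prod, map_detFactor, map_altSum, map_sub, coe_evalRingHom,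
    eval_X, eval_C, add_sub_cancel_left] using h

theorem rfacInv_sub_one (k : ℤ) : rfacInv (k - 1) = k * rfacInv k := by
  unfold rfacInv
  rcases lt_trichotomy k 0 with hk | rfl | hk
  · rw [if_neg (by omega), if_neg (by omega), mul_zero]
  · simp
  · obtain ⟨m, rfl⟩ : ∃ m : ℕ, k = m + 1 := ⟨(k - 1).toNat, by omega⟩
    rw [if_pos (by omega), if_pos (by omega), add_sub_cancel_right, Int.toNat_natCast,
      show ((m : ℤ) + 1).toNat = m + 1 by omega, Nat.factorial_succ]
    push_cast
    have : (m.factorial : ℚ) ≠ 0 := by positivity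
    have : (m : ℚ) + 1 ≠ 0 := by positivity
    field_simp

theorem rfacInv_sub (m j : ℕ) :
    rfacInv ((m : ℤ) - j) = (m.factorial : ℚ)⁻¹ * rising ((m : ℚ) - j + 1) j := by
  induction j with
  | zero => simp [rfacInv, rising]
  | succ j ih =>
    have h := rfacInv_sub_one ((m : ℤ) - j)
    rw [ih, sub_sub] at h
    push_cast at h ⊢
    rw [h, rising_succ', show (m : ℚ) - (j + 1) + 1 = m - j by ring]
    ring

theorem rfac_eq_mul_rising (s : ℕ) (hs : 1 ≤ s) (k : ℕ) :
    ((s + k - 1).factorial : ℚ) = ((s - 1).factorial : ℚ) * rising (s : ℚ) k := by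
  obtain ⟨s, rfl⟩ := Nat.exists_eq_add_of_le' hs
  induction k with
  | zero => simp [rising]
  | succ k ih =>
    rw [rising_succ, ← mul_assoc, ← ih, show s + 1 + (k + 1) - 1 = s + k + 1 by omega,
      show s + 1 + k - 1 = s + k by omega, Nat.factorial_succ]
    push_cast
    ring

theorem Edet_eq_scaledDet (x y n : ℕ) (h : 1 ≤ x + y) :
    Edet x y n = (∏ i ∈ range n, ((x + y - 1).factorial : ℚ) * ((x + 2 * i + 1).factorial : ℚ)⁻¹ *
      ((y + 2 * i + 1).factorial : ℚ)⁻¹) * scaledDet (x : ℚ) (y : ℚ) n := by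
  rw [scaledDet, ← det_of_mul_mul (fun i => ((x + y - 1).factorial : ℚ) *
    ((x + 2 * i + 1).factorial : ℚ)⁻¹) (fun j => ((y + 2 * j + 1).factorial : ℚ)⁻¹), Edet]
  congr 1
  ext i j
  have h₁ := rfacInv_sub (x + 2 * i + 1) j
  have h₂ := rfacInv_sub (y + 2 * j + 1) i
  have h₃ := rfac_eq_mul_rising (x + y) h (i + j)
  push_cast at h₁ h₂ h₃
  have h₄ : rfac ((x : ℤ) + (y : ℤ) + (i : ℕ) + (j : ℕ) - 1) =
      ((x + y + (i + j) - 1).factorial : ℚ) := by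
    rw [rfac, if_pos (by omega)]
    congr 2
    omega
  simp only [Matrix.of_apply]
  rw [h₄, h₃, show (x : ℤ) + 2 * (i : ℕ) - (j : ℕ) + 1 = x + 2 * (i : ℕ) + 1 - (j : ℕ) by ring, h₁,
    show (y : ℤ) + 2 * (j : ℕ) - (i : ℕ) + 1 = y + 2 * (j : ℕ) + 1 - (i : ℕ) by ring, h₂,
    scaledEntry,
    show (x : ℚ) + 2 * (i : ℕ) + 1 - (j : ℕ) + 1 = x + 2 * (i : ℕ) - (j : ℕ) + 2 by ring,
    show (y : ℚ) + 2 * (j : ℕ) + 1 - (i : ℕ) + 1 = y + 2 * (j : ℕ) - (i : ℕ) + 2 by ring]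
  push_cast
  ring

/-- Theorem 8. -/
theorem thm8 (x y n : ℕ) (h : 1 ≤ x + y) :
    Edet x y n =
      (∏ i ∈ Finset.range n,
        ((Nat.factorial i : ℚ) * (Nat.factorial (x + y + i - 1) : ℚ) *
            poch (2 * x + y + 2 * i + 1 : ℚ) i * poch (x + 2 * y + 2 * i + 1 : ℚ) i /
          ((Nat.factorial (x + 2 * i + 1) : ℚ) * (Nat.factorial (y + 2 * i + 1) : ℚ)))) *
      (∑ k ∈ Finset.range (n + 1),
        (-1 : ℚ) ^ k * (n.choose k : ℚ) * poch (x : ℚ) k * poch (y : ℚ) (n - k)) := by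
  have hxy : (0 : ℚ) < (x : ℚ) + y := by exact_mod_cast h
  rw [Edet_eq_scaledDet x y n h, scaledDet_eq _ _ hxy, ← mul_assoc, ← prod_mul_distrib,
    altSum_eq_sum]
  congr 1
  refine prod_congr rfl fun i _ => ?_
  rw [rfac_eq_mul_rising (x + y) h i, detFactor]
  push_cast
  simp only [poch, rising]
  ring
end

section
/- Let x, y, n be nonnegative integers with x + y ≥ 1. Then det_{0≤i,j≤n−1}( (x+y+i+j−1)! / ((x+2i−j)! · (y+2j−i)!) ) = ∏_{i=0}^{n−1} i! · (x+y+i−1)! · (2x+y+2i)_i · (x+2y+2i)_i / ((x+2i)! · (y+2i)!). (Theorem 10, equation (5.3)) -/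
open Finset

namespace Matrix

section Jacobi

variable {m n R : Type*} [Fintype m] [Fintype n] [DecidableEq m] [DecidableEq n] [CommRing R]

/-- A form of Jacobi's complementary minor identity, before cancelling `A.det`. -/
theorem det_mul_det_toBlocks₁₁_adjugate (A : Matrix (m ⊕ n) (m ⊕ n) R) :
    A.det * A.adjugate.toBlocks₁₁.det = A.det ^ Fintype.card m * A.toBlocks₂₂.det := by
  have h : fromBlocks A.toBlocks₁₁ A.toBlocks₁₂ A.toBlocks₂₁ A.toBlocks₂₂ *
      fromBlocks A.adjugate.toBlocks₁₁ A.adjugate.toBlocks₁₂ A.adjugate.toBlocks₂₁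
        A.adjugate.toBlocks₂₂ = A.det • fromBlocks 1 0 0 1 := by
    rw [fromBlocks_toBlocks, fromBlocks_toBlocks, fromBlocks_one, mul_adjugate]
  rw [fromBlocks_multiply, fromBlocks_smul, fromBlocks_inj] at h
  have h₁ : A.toBlocks₁₁ * A.adjugate.toBlocks₁₁ + A.toBlocks₁₂ * A.adjugate.toBlocks₂₁
      = A.det • 1 := by
    simpa using h.1
  have h₂ : A.toBlocks₂₁ * A.adjugate.toBlocks₁₁ + A.toBlocks₂₂ * A.adjugate.toBlocks₂₁ = 0 := by
    simpa using h.2.2.1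
  have key : A * fromBlocks A.adjugate.toBlocks₁₁ 0 A.adjugate.toBlocks₂₁ 1
      = fromBlocks (A.det • 1) A.toBlocks₁₂ 0 A.toBlocks₂₂ := by
    conv_lhs => rw [← fromBlocks_toBlocks A]
    rw [fromBlocks_multiply]
    simp only [fromBlocks_toBlocks, h₁, h₂, Matrix.mul_zero, Matrix.mul_one, zero_add]
  have hdet := congrArg det key
  rwa [det_mul, det_fromBlocks_zero₁₂, det_fromBlocks_zero₂₁, det_one, mul_one, det_smul, det_one,
    mul_one] at hdet

theorem det_toBlocks₁₁_adjugate (A : Matrix (Fin 2 ⊕ n) (Fin 2 ⊕ n) R) :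
    A.adjugate.toBlocks₁₁.det = A.det * A.toBlocks₂₂.det := by
  let X := mvPolynomialX (Fin 2 ⊕ n) (Fin 2 ⊕ n) ℤ
  have hX : X.adjugate.toBlocks₁₁.det = X.det * X.toBlocks₂₂.det := by
    refine mul_left_cancel₀ (det_mvPolynomialX_ne_zero (Fin 2 ⊕ n) ℤ) ?_
    have := det_mul_det_toBlocks₁₁_adjugate X
    rw [Fintype.card_fin] at this
    linear_combination this
  let φ : MvPolynomial ((Fin 2 ⊕ n) × (Fin 2 ⊕ n)) ℤ →+* R :=
    MvPolynomial.eval₂Hom (Int.castRingHom R) fun p => A p.1 p.2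
  have hA : φ.mapMatrix X = A := by
    ext i j
    simp [φ, X]
  have h := congrArg φ hX
  rw [map_mul, RingHom.map_det, RingHom.map_det, RingHom.map_det] at h
  have e₁ : φ.mapMatrix X.adjugate.toBlocks₁₁ = (φ.mapMatrix X.adjugate).toBlocks₁₁ := rfl
  have e₂ : φ.mapMatrix X.toBlocks₂₂ = (φ.mapMatrix X).toBlocks₂₂ := rfl
  rwa [e₁, e₂, RingHom.map_adjugate, hA] at h

end Jacobi

/-- The reindexing of `Fin (n + 2)` separating the two extreme indices from the inner ones. -/
noncomputable def outerInnerEquiv (n : ℕ) : Fin 2 ⊕ Fin n ≃ Fin (n + 2) :=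
  Equiv.ofBijective (Sum.elim ![0, Fin.last (n + 1)] fun k => k.succ.castSucc) <| by
    rw [Fintype.bijective_iff_injective_and_card]
    refine ⟨?_, by simp [add_comm]⟩
    rintro (a | a) (b | b) h
    · fin_cases a <;> fin_cases b <;> simp_all [Fin.ext_iff]
    · fin_cases a <;> simp_all [Fin.ext_iff]
      have := b.2
      omega
    · fin_cases b <;> simp_all [Fin.ext_iff]
      have := a.2
      omega
    · simp_all [Fin.ext_iff]

/-- The Desnanot–Jacobi identity (Dodgson condensation). -/
theorem det_mul_det_inner {R : Type*} [CommRing R] {n : ℕ}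
    (A : Matrix (Fin (n + 2)) (Fin (n + 2)) R) :
    A.det * (A.submatrix (fun k : Fin n => k.succ.castSucc) fun k => k.succ.castSucc).det =
      (A.submatrix Fin.castSucc Fin.castSucc).det * (A.submatrix Fin.succ Fin.succ).det -
      (A.submatrix Fin.succ Fin.castSucc).det * (A.submatrix Fin.castSucc Fin.succ).det := by
  have h := det_toBlocks₁₁_adjugate (A.submatrix (outerInnerEquiv n) (outerInnerEquiv n))
  rw [det_submatrix_equiv_self, adjugate_submatrix_equiv_self, det_fin_two] at h
  have e₀ : outerInnerEquiv n (Sum.inl 0) = 0 := rfl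
  have e₁ : outerInnerEquiv n (Sum.inl 1) = Fin.last (n + 1) := rfl
  have e₂ : (A.submatrix (outerInnerEquiv n) (outerInnerEquiv n)).toBlocks₂₂ =
    A.submatrix (fun k : Fin n => k.succ.castSucc) fun k => k.succ.castSucc := rfl
  have hc : (Fin.last (n + 1)).succAbove = Fin.castSucc := by
    ext k; simp
  have hs : (0 : Fin (n + 2)).succAbove = Fin.succ := by
    ext k; simp
  simp only [toBlocks₁₁, of_apply, submatrix_apply, e₀, e₁,
    adjugate_fin_succ_eq_det_submatrix, hc, hs] at h
  rw [e₂] at h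
  have hsign : ((-1 : R) ^ (n + 1)) * (-1) ^ (n + 1) = 1 := by
    rw [← mul_pow]; simp
  simp only [Fin.val_zero, Fin.val_last, add_zero, zero_add, pow_zero, one_mul, pow_add (-1 : R)
    (n + 1) (n + 1), hsign] at h
  linear_combination -h - (A.submatrix Fin.succ Fin.castSucc).det *
    (A.submatrix Fin.castSucc Fin.succ).det * hsign

end Matrix

/-- The entries of the matrix of `thm10_53`, with integer parameters. -/
noncomputable def factorialEntry (x y : ℤ) (i j : ℕ) : ℚ :=
  rfac (x + y + i + j - 1) * rfacInv (x + 2 * i - j) * rfacInv (y + 2 * j - i)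

theorem factorialEntry_congr {x y x' y' : ℤ} {i j i' j' : ℕ}
    (h₁ : x + y + i + j = x' + y' + i' + j') (h₂ : x + 2 * i - j = x' + 2 * i' - j')
    (h₃ : y + 2 * j - i = y' + 2 * j' - i') :
    factorialEntry x y i j = factorialEntry x' y' i' j' := by
  rw [factorialEntry, factorialEntry, h₁, h₂, h₃]

/-- The determinant of `thm10_53`, with integer parameters. -/
noncomputable def factorialDet (n : ℕ) (x y : ℤ) : ℚ :=
  Matrix.det (Matrix.of fun i j : Fin n => factorialEntry x y i j)

theorem factorialDet_condensation (n : ℕ) (x y : ℤ) :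
    factorialDet (n + 2) x y * factorialDet n (x + 1) (y + 1) =
      factorialDet (n + 1) x y * factorialDet (n + 1) (x + 1) (y + 1) -
        factorialDet (n + 1) (x + 2) (y - 1) * factorialDet (n + 1) (x - 1) (y + 2) := by
  have h := Matrix.det_mul_det_inner
    (Matrix.of fun i j : Fin (n + 2) => factorialEntry x y i j)
  unfold factorialDet
  convert h using 4
  all_goals
    ext i j
    simp only [Matrix.of_apply, Matrix.submatrix_apply]
    apply factorialEntry_congr <;> simp only [Fin.val_succ, Fin.val_castSucc] <;> omega

theorem rfacInv_of_neg {k : ℤ} (hk : k < 0) : rfacInv k = 0 := if_neg hk.not_ge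

theorem factorialDet_neg_one_left (n : ℕ) (y : ℤ) : factorialDet (n + 1) (-1) y = 0 := by
  refine Matrix.det_eq_zero_of_row_eq_zero 0 fun j => ?_
  rw [Matrix.of_apply, factorialEntry, rfacInv_of_neg (k := -1 + _ - _)]
  · simp
  · simp only [Fin.val_zero]; omega

theorem factorialDet_neg_one_right (n : ℕ) (x : ℤ) : factorialDet (n + 1) x (-1) = 0 := by
  refine Matrix.det_eq_zero_of_column_eq_zero 0 fun i => ?_
  rw [Matrix.of_apply, factorialEntry, rfacInv_of_neg (k := -1 + _ - _)]
  · simp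
  · simp only [Fin.val_zero]; omega

theorem poch_pos {a : ℚ} (ha : 0 < a) (k : ℕ) : 0 < poch a k :=
  Finset.prod_pos fun i _ => by positivity

theorem poch_succ_left (a : ℚ) (k : ℕ) : poch a (k + 1) = a * poch (a + 1) k := by
  rw [poch, Finset.prod_range_succ', poch, mul_comm]
  congr 1
  · simp
  · refine Finset.prod_congr rfl fun i _ => ?_
    push_cast
    ring

/-- The factors of the product in `thm10_53`. -/
noncomputable def prodFactor (i x y : ℕ) : ℚ :=
  (Nat.factorial i : ℚ) * (Nat.factorial (x + y + i - 1) : ℚ) *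
      poch (2 * x + y + 2 * i : ℚ) i * poch (x + 2 * y + 2 * i : ℚ) i /
    ((Nat.factorial (x + 2 * i) : ℚ) * (Nat.factorial (y + 2 * i) : ℚ))

/-- The product in `thm10_53`. -/
noncomputable def factorialProd (n x y : ℕ) : ℚ := ∏ i ∈ Finset.range n, prodFactor i x y

theorem factorialProd_succ (n x y : ℕ) :
    factorialProd (n + 1) x y = factorialProd n x y * prodFactor n x y :=
  Finset.prod_range_succ _ _

theorem factorialProd_pos (n : ℕ) {x y : ℕ} (h : 1 ≤ x + y) : 0 < factorialProd n x y := by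
  have h' : (1 : ℚ) ≤ x + y := by exact_mod_cast h
  refine Finset.prod_pos fun i _ => ?_
  have hx : (0 : ℚ) ≤ x := by positivity
  have hy : (0 : ℚ) ≤ y := by positivity
  have hi : (0 : ℚ) ≤ i := by positivity
  have h₁ := poch_pos (a := 2 * x + y + 2 * i) (by linarith) i
  have h₂ := poch_pos (a := x + 2 * y + 2 * i) (by linarith) i
  unfold prodFactor
  positivity

theorem prodFactor_succ (m x y : ℕ) :
    prodFactor (m + 1) x y * ((x + y + m + 1) * (x + 2 * m + 2) * (y + 2 * m + 2)) =
      prodFactor m (x + 1) (y + 1) *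
        ((m + 1) * (2 * x + y + 2 * m + 2) * (x + 2 * y + 2 * m + 2)) := by
  have e₁ : x + y + (m + 1) - 1 = x + y + m := by omega
  have e₂ : x + 1 + (y + 1) + m - 1 = x + y + m + 1 := by omega
  have e₃ (z : ℕ) : z + 2 * (m + 1) = z + 2 * m + 1 + 1 := by ring
  have e₄ (z : ℕ) : z + 1 + 2 * m = z + 2 * m + 1 := by ring
  have p₁ : (2 * (x + 1) + (y + 1) + 2 * m : ℚ) = 2 * x + y + 2 * (m + 1) + 1 := by ring
  have p₂ : ((x + 1) + 2 * (y + 1) + 2 * m : ℚ) = x + 2 * y + 2 * (m + 1) + 1 := by ring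
  unfold prodFactor
  rw [e₁, e₂, e₃, e₃, e₄, e₄]
  push_cast [Nat.factorial_succ]
  rw [p₁, p₂, poch_succ_left, poch_succ_left]
  have := Nat.factorial_ne_zero (x + 2 * m)
  have := Nat.factorial_ne_zero (y + 2 * m)
  field_simp
  ring

theorem prodFactor_mul_prodFactor (m x y : ℕ) :
    prodFactor m (x + 3) y * prodFactor m x (y + 3) *
        ((x + y + m + 3) * (x + 2 * m + 3) * (y + 2 * m + 3)) =
      prodFactor m (x + 1) (y + 1) * prodFactor m (x + 2) (y + 2) *
        ((x + y + m + 2) * (x + 2 * m + 1) * (y + 2 * m + 1)) := by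
  have e₁ : x + 3 + y + m - 1 = x + y + m + 1 + 1 := by omega
  have e₂ : x + (y + 3) + m - 1 = x + y + m + 1 + 1 := by omega
  have e₃ : x + 1 + (y + 1) + m - 1 = x + y + m + 1 := by omega
  have e₄ : x + 2 + (y + 2) + m - 1 = x + y + m + 1 + 1 + 1 := by omega
  have f₁ (z : ℕ) : z + 1 + 2 * m = z + 2 * m + 1 := by ring
  have f₂ (z : ℕ) : z + 2 + 2 * m = z + 2 * m + 1 + 1 := by ring
  have f₃ (z : ℕ) : z + 3 + 2 * m = z + 2 * m + 1 + 1 + 1 := by ring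
  have p₁ : (2 * (x + 3) + y + 2 * m : ℚ) = 2 * x + y + 2 * m + 6 := by ring
  have p₂ : (x + 3 + 2 * y + 2 * m : ℚ) = x + 2 * y + 2 * m + 3 := by ring
  have p₃ : (2 * x + (y + 3) + 2 * m : ℚ) = 2 * x + y + 2 * m + 3 := by ring
  have p₄ : (x + 2 * (y + 3) + 2 * m : ℚ) = x + 2 * y + 2 * m + 6 := by ring
  have p₅ : (2 * (x + 1) + (y + 1) + 2 * m : ℚ) = 2 * x + y + 2 * m + 3 := by ring
  have p₆ : ((x + 1) + 2 * (y + 1) + 2 * m : ℚ) = x + 2 * y + 2 * m + 3 := by ring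
  have p₇ : (2 * (x + 2) + (y + 2) + 2 * m : ℚ) = 2 * x + y + 2 * m + 6 := by ring
  have p₈ : ((x + 2) + 2 * (y + 2) + 2 * m : ℚ) = x + 2 * y + 2 * m + 6 := by ring
  unfold prodFactor
  rw [e₁, e₂, e₃, e₄]
  rw [f₃, f₃, f₂, f₂, f₁, f₁]
  push_cast [Nat.factorial_succ]
  rw [p₁, p₂, p₃, p₄, p₅, p₆, p₇, p₈]
  have := Nat.factorial_ne_zero (x + 2 * m)
  have := Nat.factorial_ne_zero (y + 2 * m)
  field_simp
  ring

theorem factorialProd_mul_factorialProd (m x y : ℕ) :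
    factorialProd m (x + 3) y * factorialProd m x (y + 3) *
        ((x + y + m + 2) * (x + 2 * m + 1) * (y + 2 * m + 1)) =
      factorialProd m (x + 1) (y + 1) * factorialProd m (x + 2) (y + 2) *
        ((x + y + 2) * (x + 1) * (y + 1)) := by
  induction m with
  | zero => simp [factorialProd]
  | succ m ih =>
    have hK : ((x + y + m + 2) * (x + 2 * m + 1) * (y + 2 * m + 1) : ℚ) ≠ 0 := by positivity
    refine mul_right_cancel₀ hK ?_
    simp only [factorialProd_succ]
    push_cast
    linear_combination
      (factorialProd m (x + 3) y * factorialProd m x (y + 3) *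
        ((x + y + m + 2) * (x + 2 * m + 1) * (y + 2 * m + 1))) * prodFactor_mul_prodFactor m x y +
      prodFactor m (x + 1) (y + 1) * prodFactor m (x + 2) (y + 2) *
        ((x + y + m + 2) * (x + 2 * m + 1) * (y + 2 * m + 1)) * ih

theorem factorialProd_condensation (n x y : ℕ) :
    factorialProd (n + 2) (x + 1) (y + 1) * factorialProd n (x + 2) (y + 2) =
      factorialProd (n + 1) (x + 1) (y + 1) * factorialProd (n + 1) (x + 2) (y + 2) -
        factorialProd (n + 1) (x + 3) y * factorialProd (n + 1) x (y + 3) := by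
  have hK : ((x + y + n + 3) * (x + 2 * n + 3) * (y + 2 * n + 3) : ℚ) ≠ 0 := by positivity
  refine mul_right_cancel₀ hK ?_
  have h₁ := factorialProd_mul_factorialProd (n + 1) x y
  have h₂ := prodFactor_succ n (x + 1) (y + 1)
  rw [factorialProd_succ (n + 1) (x + 1), factorialProd_succ n (x + 2)] at *
  push_cast at h₁ h₂
  linear_combination h₁ +
    factorialProd (n + 1) (x + 1) (y + 1) * factorialProd n (x + 2) (y + 2) * h₂

theorem factorialProd_condensation_of_mul_eq_zero {n x y : ℕ}
    (hxy : x * y = 0) :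
    factorialProd (n + 2) x y * factorialProd n (x + 1) (y + 1) =
      factorialProd (n + 1) x y * factorialProd (n + 1) (x + 1) (y + 1) := by
  have hK : ((x + y + n + 1) * (x + 2 * n + 2) * (y + 2 * n + 2) : ℚ) ≠ 0 := by positivity
  refine mul_right_cancel₀ hK ?_
  have hxy' : (x * y : ℚ) = 0 := by exact_mod_cast hxy
  have h₂ := prodFactor_succ n x y
  rw [factorialProd_succ (n + 1) x, factorialProd_succ n (x + 1)]
  linear_combination
    factorialProd (n + 1) x y * factorialProd n (x + 1) (y + 1) * h₂ -
    factorialProd (n + 1) x y * factorialProd n (x + 1) (y + 1) *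
      prodFactor n (x + 1) (y + 1) * (x + y) * hxy'

theorem factorialDet_zero (x y : ℤ) : factorialDet 0 x y = 1 := Matrix.det_fin_zero

theorem factorialDet_one {x y : ℕ} (h : 1 ≤ x + y) :
    factorialDet 1 x y = factorialProd 1 x y := by
  have e : ((x : ℤ) + y - 1).toNat = x + y - 1 := by omega
  have e' : (1 : ℤ) ≤ x + y := by omega
  simp [factorialDet, factorialProd, factorialEntry, prodFactor, rfac, rfacInv, poch, e, e']
  field_simp

theorem factorialDet_eq_factorialProd (n : ℕ) :
    ∀ {x y : ℕ}, 1 ≤ x + y → factorialDet n x y = factorialProd n x y := by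
  induction n using Nat.strong_induction_on with
  | _ n ih =>
    intro x y h
    match n, ih with
    | 0, _ => simp [factorialDet_zero, factorialProd]
    | 1, _ => exact factorialDet_one h
    | n + 2, ih =>
      have hpos := factorialProd_pos n (x := x + 1) (y := y + 1) (by omega)
      refine mul_right_cancel₀ hpos.ne' ?_
      have hc := factorialDet_condensation n x y
      have i₁ := ih n (by omega) (x := x + 1) (y := y + 1) (by omega)
      have i₂ := ih (n + 1) (by omega) h
      have i₃ := ih (n + 1) (by omega) (x := x + 1) (y := y + 1) (by omega)
      push_cast at i₁ i₃
      rw [i₁, i₂, i₃] at hc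
      rw [hc]
      rcases x with _ | x
      · rw [factorialProd_condensation_of_mul_eq_zero (by simp)]
        simp [factorialDet_neg_one_left]
      rcases y with _ | y
      · rw [factorialProd_condensation_of_mul_eq_zero (by simp)]
        simp [factorialDet_neg_one_right]
      have i₄ := ih (n + 1) (by omega) (x := x + 3) (y := y) (by omega)
      have i₅ := ih (n + 1) (by omega) (x := x) (y := y + 3) (by omega)
      rw [factorialProd_condensation, ← i₄, ← i₅]
      push_cast
      congr 3 <;> ring

/-- Theorem 10, equation (5.3). -/
theorem thm10_53 (x y n : ℕ) (h : 1 ≤ x + y) :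
    Matrix.det (Matrix.of fun i j : Fin n =>
        rfac ((x : ℤ) + (y : ℤ) + (i : ℕ) + (j : ℕ) - 1) *
          rfacInv ((x : ℤ) + 2 * (i : ℕ) - (j : ℕ)) *
          rfacInv ((y : ℤ) + 2 * (j : ℕ) - (i : ℕ))) =
      ∏ i ∈ Finset.range n,
        ((Nat.factorial i : ℚ) * (Nat.factorial (x + y + i - 1) : ℚ) *
            poch (2 * x + y + 2 * i : ℚ) i * poch (x + 2 * y + 2 * i : ℚ) i /
          ((Nat.factorial (x + 2 * i) : ℚ) * (Nat.factorial (y + 2 * i) : ℚ))) := by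
  exact factorialDet_eq_factorialProd n h
end

section
/- Let x, y, n be nonnegative integers with x + y ≥ 1. Then det_{0≤i,j≤n−1}( C(x+y+i+j, y+2j−i) + C(x+y+i+j−1, y+2j−i−1) ) = ∏_{i=0}^{n−1} i! · (x+y+i−1)! · (2x+y+2i)_i · (x+2y+2i)_{i+1} / ((x+2i)! · (y+2i)!). (Theorem 10, equation (5.4)) -/
open Finset

/-- The binomial coefficient `C(N,r)` for integers, equal to `0` for `r < 0` or `r > N`. -/
def ibinom (N r : ℤ) : ℤ := if 0 ≤ r ∧ r ≤ N then ((N.toNat).choose r.toNat : ℤ) else 0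

open Matrix

/-- The Desnanot–Jacobi identity for a block matrix whose lower right block is invertible. -/
lemma det_mul_det_toBlocks₂₂ {m : Type*} [Fintype m] [DecidableEq m]
    (X : Matrix (Fin 2 ⊕ m) (Fin 2 ⊕ m) ℚ) (hD : X.toBlocks₂₂.det ≠ 0) :
    X.det * X.toBlocks₂₂.det =
      (X.submatrix (Sum.map (fun _ : Fin 1 => 0) id) (Sum.map (fun _ : Fin 1 => 0) id)).det *
        (X.submatrix (Sum.map (fun _ : Fin 1 => 1) id) (Sum.map (fun _ : Fin 1 => 1) id)).det -
      (X.submatrix (Sum.map (fun _ : Fin 1 => 0) id) (Sum.map (fun _ : Fin 1 => 1) id)).det *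
        (X.submatrix (Sum.map (fun _ : Fin 1 => 1) id) (Sum.map (fun _ : Fin 1 => 0) id)).det := by
  have : Invertible X.toBlocks₂₂ := invertibleOfIsUnitDet _ (isUnit_iff_ne_zero.mpr hD)
  set S := X.toBlocks₁₁ - X.toBlocks₁₂ * ⅟X.toBlocks₂₂ * X.toBlocks₂₁ with hS
  have hX : X.det = X.toBlocks₂₂.det * S.det := by
    conv_lhs => rw [← fromBlocks_toBlocks X]
    rw [det_fromBlocks₂₂]
  have hb (p q : Fin 2) : (X.submatrix (Sum.map (fun _ : Fin 1 => p) id)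
      (Sum.map (fun _ : Fin 1 => q) id)).det = X.toBlocks₂₂.det * S p q := by
    have : X.submatrix (Sum.map (fun _ : Fin 1 => p) id) (Sum.map (fun _ : Fin 1 => q) id) =
        fromBlocks (X.toBlocks₁₁.submatrix (fun _ => p) (fun _ => q))
          (X.toBlocks₁₂.submatrix (fun _ => p) id) (X.toBlocks₂₁.submatrix id (fun _ => q))
          X.toBlocks₂₂ := by
      ext (i | i) (j | j) <;> rfl
    rw [this, det_fromBlocks₂₂, det_fin_one]
    rfl
  rw [hX, hb, hb, hb, hb, det_fin_two]
  ring

lemma det_submatrix_mul_det_submatrix_swap {m n : Type*} [Fintype m] [DecidableEq m] [Fintype n]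
    [DecidableEq n] (e₁ e₂ : m ≃ n) (A B : Matrix n n ℚ) :
    (A.submatrix e₁ e₂).det * (B.submatrix e₂ e₁).det = A.det * B.det := by
  have hA : A.submatrix e₁ e₂ = (A.submatrix e₁ e₁).submatrix id (e₂.trans e₁.symm) := by
    ext; simp
  have hB : B.submatrix e₂ e₁ = (B.submatrix e₁ e₁).submatrix (e₂.trans e₁.symm) id := by
    ext; simp
  rw [hA, hB, det_permute', det_permute, det_submatrix_equiv_self, det_submatrix_equiv_self]
  have h' : ((Equiv.Perm.sign (e₂.trans e₁.symm) : ℤ) : ℚ) *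
      ((Equiv.Perm.sign (e₂.trans e₁.symm) : ℤ) : ℚ) = 1 := by
    rw [← Int.cast_mul, Int.units_coe_mul_self, Int.cast_one]
  linear_combination (A.det * B.det) * h'

/-- The Desnanot–Jacobi identity (Dodgson condensation), for an invertible central minor. -/
lemma det_mul_det_center {k : ℕ} (M : Matrix (Fin (k + 2)) (Fin (k + 2)) ℚ)
    (hD : (M.submatrix (fun i : Fin k => i.castSucc.succ) (fun i => i.castSucc.succ)).det ≠ 0) :
    M.det * (M.submatrix (fun i : Fin k => i.castSucc.succ) (fun i => i.castSucc.succ)).det =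
      (M.submatrix Fin.castSucc Fin.castSucc).det * (M.submatrix Fin.succ Fin.succ).det -
        (M.submatrix Fin.castSucc Fin.succ).det * (M.submatrix Fin.succ Fin.castSucc).det := by
  have h₁ : Function.Bijective
      (Sum.elim (fun _ => 0) Fin.succ : Fin 1 ⊕ Fin k → Fin (k + 1)) := by
    rw [Fintype.bijective_iff_injective_and_card]
    refine ⟨?_, by simp [add_comm]⟩
    rintro (i | i) (j | j) hij <;> simp_all [Fin.ext_iff]
  have h₂ : Function.Bijective
      (Sum.elim (fun _ => Fin.last k) Fin.castSucc : Fin 1 ⊕ Fin k → Fin (k + 1)) := by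
    rw [Fintype.bijective_iff_injective_and_card]
    refine ⟨?_, by simp [add_comm]⟩
    rintro (i | i) (j | j) hij <;> simp_all [Fin.ext_iff] <;> omega
  have h₃ : Function.Bijective (Sum.elim ![0, Fin.last (k + 1)] (fun i => i.castSucc.succ) :
      Fin 2 ⊕ Fin k → Fin (k + 2)) := by
    rw [Fintype.bijective_iff_injective_and_card]
    refine ⟨?_, by simp [add_comm]⟩
    rintro (i | i) (j | j) hij
    · fin_cases i <;> fin_cases j <;> simp_all [Fin.ext_iff]
    · fin_cases i <;> simp_all [Fin.ext_iff]
      omega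
    · fin_cases j <;> simp_all [Fin.ext_iff]
      omega
    · simp_all [Fin.ext_iff]
  have key := det_mul_det_toBlocks₂₂
    (M.submatrix (Equiv.ofBijective _ h₃) (Equiv.ofBijective _ h₃)) hD
  rw [det_submatrix_equiv_self] at key
  refine key.trans ?_
  rw [← det_submatrix_mul_det_submatrix_swap (Equiv.ofBijective _ h₁) (Equiv.ofBijective _ h₂)
      (M.submatrix Fin.castSucc Fin.succ),
    ← det_submatrix_equiv_self (Equiv.ofBijective _ h₁) (M.submatrix Fin.castSucc Fin.castSucc),
    ← det_submatrix_equiv_self (Equiv.ofBijective _ h₂) (M.submatrix Fin.succ Fin.succ)]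
  have h₁₀ : Fin.castSucc ∘ (Equiv.ofBijective _ h₁) =
      (Equiv.ofBijective _ h₃) ∘ Sum.map (fun _ : Fin 1 => 0) id := by
    funext i; rcases i with i | i <;> rfl
  have h₂₁ : Fin.succ ∘ (Equiv.ofBijective _ h₂) =
      (Equiv.ofBijective _ h₃) ∘ Sum.map (fun _ : Fin 1 => 1) id := by
    funext i; rcases i with i | i <;> rfl
  simp only [submatrix_submatrix, h₁₀, h₂₁]

/-- The reciprocal factorial `1 / k!`, equal to `0` at negative integers. -/
def rfact (k : ℤ) : ℚ := if 0 ≤ k then 1 / (k.toNat.factorial : ℚ) else 0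

/-- The entry `(x+y+i+j-1)! / ((x+2i-j)! (y+2j-i)!)`. -/
def entry (x y : ℤ) (i j : ℕ) : ℚ :=
  ((x + y + i + j - 1).toNat.factorial : ℚ) * rfact (x + 2 * i - j) * rfact (y + 2 * j - i)

lemma entry_congr {x y x' y' : ℤ} {i j i' j' : ℕ}
    (h : x + y + i + j = x' + y' + i' + j') (hx : x + 2 * i - j = x' + 2 * i' - j')
    (hy : y + 2 * j - i = y' + 2 * j' - i') : entry x y i j = entry x' y' i' j' := by
  rw [entry, entry, h, hx, hy]

/-- The `n × n` matrix with entries `(x+y+i+j-1)! / ((x+2i-j)! (y+2j-i)!)`. -/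
def entryMatrix (n : ℕ) (x y : ℤ) : Matrix (Fin n) (Fin n) ℚ := Matrix.of fun i j => entry x y i j

/-- The `i`-th factor of the determinant of `entryMatrix`. -/
def factor (i x y : ℕ) : ℚ :=
  (i.factorial * (x + y + i - 1).factorial * (2 * x + y + 3 * i - 1).factorial *
      (x + 2 * y + 3 * i - 1).factorial : ℚ) /
    ((2 * x + y + 2 * i - 1).factorial * (x + 2 * y + 2 * i - 1).factorial *
      (x + 2 * i).factorial * (y + 2 * i).factorial)

lemma factor_ne_zero (i x y : ℕ) : factor i x y ≠ 0 := by
  unfold factor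
  positivity

/-- The closed form of `factor m (x+1) (y+1) - factor (m+1) x y`. -/
def factorDiff (m x y : ℕ) : ℚ :=
  ((x + y) * x * y : ℚ) *
    (m.factorial * (x + y + m).factorial * (2 * x + y + 3 * m + 2).factorial *
      (x + 2 * y + 3 * m + 2).factorial) /
    ((2 * x + y + 2 * m + 2).factorial * (x + 2 * y + 2 * m + 2).factorial *
      (x + 2 * m + 2).factorial * (y + 2 * m + 2).factorial)

lemma factor_sub_factor (m x y : ℕ) :
    factor m (x + 1) (y + 1) - factor (m + 1) x y = factorDiff m x y := by
  unfold factor factorDiff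
  rw [show x + 1 + (y + 1) + m - 1 = x + y + m + 1 by omega,
    show 2 * (x + 1) + (y + 1) + 3 * m - 1 = 2 * x + y + 3 * m + 2 by omega,
    show x + 1 + 2 * (y + 1) + 3 * m - 1 = x + 2 * y + 3 * m + 2 by omega,
    show 2 * (x + 1) + (y + 1) + 2 * m - 1 = 2 * x + y + 2 * m + 1 + 1 by omega,
    show x + 1 + 2 * (y + 1) + 2 * m - 1 = x + 2 * y + 2 * m + 1 + 1 by omega,
    show x + 1 + 2 * m = x + 2 * m + 1 by omega,
    show y + 1 + 2 * m = y + 2 * m + 1 by omega,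
    show x + y + (m + 1) - 1 = x + y + m by omega,
    show 2 * x + y + 3 * (m + 1) - 1 = 2 * x + y + 3 * m + 2 by omega,
    show x + 2 * y + 3 * (m + 1) - 1 = x + 2 * y + 3 * m + 2 by omega,
    show 2 * x + y + 2 * (m + 1) - 1 = 2 * x + y + 2 * m + 1 by omega,
    show x + 2 * y + 2 * (m + 1) - 1 = x + 2 * y + 2 * m + 1 by omega,
    show x + 2 * (m + 1) = x + 2 * m + 1 + 1 by omega,
    show y + 2 * (m + 1) = y + 2 * m + 1 + 1 by omega,
    Nat.factorial_succ (x + y + m), Nat.factorial_succ (2 * x + y + 2 * m + 1),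
    Nat.factorial_succ (x + 2 * y + 2 * m + 1), Nat.factorial_succ (x + 2 * m + 1),
    Nat.factorial_succ (y + 2 * m + 1), Nat.factorial_succ m]
  push_cast
  field_simp
  ring

lemma prod_factor_mul_prod_factor (m x y : ℕ) :
    (∏ i ∈ range (m + 1), factor i (x + 3) y) * ∏ i ∈ range (m + 1), factor i x (y + 3) =
      factorDiff m (x + 1) (y + 1) * (∏ i ∈ range (m + 1), factor i (x + 1) (y + 1)) *
        ∏ i ∈ range m, factor i (x + 2) (y + 2) := by
  induction m with
  | zero =>
    simp only [zero_add, prod_range_one, prod_range_zero, mul_one]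
    rw [factorDiff]
    simp only [factor, mul_zero, add_zero, Nat.factorial_zero, Nat.cast_one, one_mul]
    rw [show x + 3 + y - 1 = x + y + 2 by omega, show x + (y + 3) - 1 = x + y + 2 by omega,
      show x + 1 + (y + 1) - 1 = x + y + 1 by omega,
      show x + 1 + (y + 1) = x + y + 2 by omega,
      show x + 1 + 2 = x + 3 by omega, show y + 1 + 2 = y + 3 by omega,
      Nat.factorial_succ (x + y + 1), Nat.factorial_succ x, Nat.factorial_succ y]
    push_cast
    field_simp
    ring
  | succ m ih =>
    have key : factor (m + 1) (x + 3) y * factor (m + 1) x (y + 3) * factorDiff m (x + 1) (y + 1) =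
        factorDiff (m + 1) (x + 1) (y + 1) * factor (m + 1) (x + 1) (y + 1) *
          factor m (x + 2) (y + 2) := by
      simp only [factor, factorDiff]
      simp only [
        show 2 * (x + 1) + (y + 1) + 3 * (m + 1) - 1 = 2 * x + y + 3 * m + 5 by omega,
        show 2 * (x + 1) + (y + 1) + 2 * (m + 1) - 1 = 2 * x + y + 2 * m + 4 by omega,
        show 2 * (x + 1) + (y + 1) + 3 * (m + 1) + 2 = 2 * x + y + 3 * m + 8 by omega,
        show 2 * (x + 1) + (y + 1) + 2 * (m + 1) + 2 = 2 * x + y + 2 * m + 7 by omega,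
        show x + 1 + 2 * (y + 1) + 3 * (m + 1) - 1 = x + 2 * y + 3 * m + 5 by omega,
        show x + 1 + 2 * (y + 1) + 2 * (m + 1) - 1 = x + 2 * y + 2 * m + 4 by omega,
        show x + 1 + 2 * (y + 1) + 3 * (m + 1) + 2 = x + 2 * y + 3 * m + 8 by omega,
        show x + 1 + 2 * (y + 1) + 2 * (m + 1) + 2 = x + 2 * y + 2 * m + 7 by omega,
        show 2 * (x + 3) + y + 3 * (m + 1) - 1 = 2 * x + y + 3 * m + 8 by omega,
        show 2 * (x + 3) + y + 2 * (m + 1) - 1 = 2 * x + y + 2 * m + 7 by omega,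
        show 2 * x + (y + 3) + 3 * (m + 1) - 1 = 2 * x + y + 3 * m + 5 by omega,
        show x + 2 * (y + 3) + 3 * (m + 1) - 1 = x + 2 * y + 3 * m + 8 by omega,
        show 2 * x + (y + 3) + 2 * (m + 1) - 1 = 2 * x + y + 2 * m + 4 by omega,
        show x + 2 * (y + 3) + 2 * (m + 1) - 1 = x + 2 * y + 2 * m + 7 by omega,
        show 2 * (x + 2) + (y + 2) + 3 * m - 1 = 2 * x + y + 3 * m + 5 by omega,
        show 2 * (x + 2) + (y + 2) + 2 * m - 1 = 2 * x + y + 2 * m + 5 by omega,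
        show 2 * (x + 1) + (y + 1) + 3 * m + 2 = 2 * x + y + 3 * m + 5 by omega,
        show 2 * (x + 1) + (y + 1) + 2 * m + 2 = 2 * x + y + 2 * m + 5 by omega,
        show x + 3 + 2 * y + 3 * (m + 1) - 1 = x + 2 * y + 3 * m + 5 by omega,
        show x + 3 + 2 * y + 2 * (m + 1) - 1 = x + 2 * y + 2 * m + 4 by omega,
        show x + 2 + 2 * (y + 2) + 3 * m - 1 = x + 2 * y + 3 * m + 5 by omega,
        show x + 2 + 2 * (y + 2) + 2 * m - 1 = x + 2 * y + 2 * m + 5 by omega,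
        show x + 1 + 2 * (y + 1) + 3 * m + 2 = x + 2 * y + 3 * m + 5 by omega,
        show x + 1 + 2 * (y + 1) + 2 * m + 2 = x + 2 * y + 2 * m + 5 by omega,
        show x + y + m + 3 - 1 = x + y + m + 2 by omega,
        show x + (y + 3) + (m + 1) - 1 = x + y + m + 3 by omega,
        show x + 1 + (y + 1) + (m + 1) = x + y + m + 3 by omega,
        show x + 3 + y + (m + 1) - 1 = x + y + m + 3 by omega,
        show x + 2 + (y + 2) + m - 1 = x + y + m + 3 by omega,
        show x + 3 + 2 * (m + 1) = x + 2 * m + 5 by omega,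
        show y + 3 + 2 * (m + 1) = y + 2 * m + 5 by omega,
        show x + 1 + 2 * (m + 1) = x + 2 * m + 3 by omega,
        show y + 1 + 2 * (m + 1) = y + 2 * m + 3 by omega,
        show x + 1 + (y + 1) + m = x + y + m + 2 by omega,
        show x + 1 + 2 * m + 2 = x + 2 * m + 3 by omega,
        show y + 1 + 2 * m + 2 = y + 2 * m + 3 by omega,
        show y + 2 * (m + 1) = y + 2 * m + 2 by omega,
        show x + 2 * (m + 1) = x + 2 * m + 2 by omega,
        show x + 2 + 2 * m = x + 2 * m + 2 by omega,
        show y + 2 + 2 * m = y + 2 * m + 2 by omega]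
      field_simp
    rw [prod_range_succ (fun i => factor i (x + 3) y) (m + 1),
      prod_range_succ (fun i => factor i x (y + 3)) (m + 1),
      prod_range_succ (fun i => factor i (x + 1) (y + 1)) (m + 1),
      prod_range_succ (fun i => factor i (x + 2) (y + 2)) m]
    have hne : factorDiff m (x + 1) (y + 1) ≠ 0 := by
      unfold factorDiff
      positivity
    apply mul_right_cancel₀ hne
    linear_combination (factor (m + 1) (x + 3) y * factor (m + 1) x (y + 3) *
      factorDiff m (x + 1) (y + 1)) * ih + (factorDiff m (x + 1) (y + 1) *
      (∏ i ∈ range (m + 1), factor i (x + 1) (y + 1)) *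
        ∏ i ∈ range m, factor i (x + 2) (y + 2)) * key

lemma det_entryMatrix_of_neg_left (n : ℕ) (x y : ℤ) (hx : x < 0) :
    (entryMatrix (n + 1) x y).det = 0 := by
  refine det_eq_zero_of_row_eq_zero 0 fun j => ?_
  have : rfact (x + 2 * (0 : ℕ) - (j : ℕ)) = 0 := if_neg (by push_cast; omega)
  simp only [entryMatrix, entry, of_apply, Fin.coe_ofNat_eq_mod, Nat.zero_mod, this]
  ring

lemma det_entryMatrix_of_neg_right (n : ℕ) (x y : ℤ) (hy : y < 0) :
    (entryMatrix (n + 1) x y).det = 0 := by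
  refine det_eq_zero_of_column_eq_zero 0 fun j => ?_
  have : rfact (y + 2 * (0 : ℕ) - (j : ℕ)) = 0 := if_neg (by push_cast; omega)
  simp only [entryMatrix, entry, of_apply, Fin.coe_ofNat_eq_mod, Nat.zero_mod, this]
  ring

lemma det_entryMatrix_condensation (n : ℕ) (x y : ℤ)
    (h : (entryMatrix n (x + 1) (y + 1)).det ≠ 0) :
    (entryMatrix (n + 2) x y).det * (entryMatrix n (x + 1) (y + 1)).det =
      (entryMatrix (n + 1) x y).det * (entryMatrix (n + 1) (x + 1) (y + 1)).det -
        (entryMatrix (n + 1) (x - 1) (y + 2)).det * (entryMatrix (n + 1) (x + 2) (y - 1)).det := by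
  have h₀ : (entryMatrix (n + 2) x y).submatrix (fun i : Fin n => i.castSucc.succ)
      (fun i => i.castSucc.succ) = entryMatrix n (x + 1) (y + 1) := by
    ext i j
    apply entry_congr <;> push_cast [Fin.val_succ, Fin.val_castSucc] <;> ring
  have h₁ : (entryMatrix (n + 2) x y).submatrix Fin.castSucc Fin.castSucc =
      entryMatrix (n + 1) x y := by
    ext i j
    rfl
  have h₂ : (entryMatrix (n + 2) x y).submatrix Fin.succ Fin.succ =
      entryMatrix (n + 1) (x + 1) (y + 1) := by
    ext i j
    apply entry_congr <;> push_cast [Fin.val_succ, Fin.val_castSucc] <;> ring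
  have h₃ : (entryMatrix (n + 2) x y).submatrix Fin.castSucc Fin.succ =
      entryMatrix (n + 1) (x - 1) (y + 2) := by
    ext i j
    apply entry_congr <;> push_cast [Fin.val_succ, Fin.val_castSucc] <;> ring
  have h₄ : (entryMatrix (n + 2) x y).submatrix Fin.succ Fin.castSucc =
      entryMatrix (n + 1) (x + 2) (y - 1) := by
    ext i j
    apply entry_congr <;> push_cast [Fin.val_succ, Fin.val_castSucc] <;> ring
  have key := det_mul_det_center (entryMatrix (n + 2) x y)
  rw [h₀, h₁, h₂, h₃, h₄] at key
  exact key h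

theorem det_entryMatrix (n x y : ℕ) (h : 1 ≤ x + y) :
    (entryMatrix n x y).det = ∏ i ∈ range n, factor i x y := by
  induction n using Nat.strong_induction_on generalizing x y with
  | _ n ih =>
    match n with
    | 0 => simp
    | 1 =>
      rw [det_fin_one, prod_range_one]
      simp only [entryMatrix, entry, rfact, of_apply, factor, Fin.val_zero]
      rw [if_pos (by simp), if_pos (by simp)]
      simp only [Nat.cast_zero, mul_zero, add_zero, sub_zero, Int.toNat_natCast,
        Nat.factorial_zero, Nat.cast_one, one_mul]
      rw [show ((x : ℤ) + y - 1).toNat = x + y - 1 by omega]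
      field_simp
    | n + 2 =>
      have hc := ih n (by omega) (x + 1) (y + 1) (by omega)
      have hne : ∏ i ∈ range n, factor i (x + 1) (y + 1) ≠ 0 :=
        prod_ne_zero_iff.mpr fun i _ => factor_ne_zero _ _ _
      have h₁ := ih (n + 1) (by omega) x y h
      have h₂ := ih (n + 1) (by omega) (x + 1) (y + 1) (by omega)
      push_cast at hc h₂
      have key := det_entryMatrix_condensation n x y (by rwa [hc])
      have hoff : (entryMatrix (n + 1) (x - 1) (y + 2)).det *
          (entryMatrix (n + 1) (x + 2) (y - 1)).det =
          factorDiff n x y * (∏ i ∈ range (n + 1), factor i x y) *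
            ∏ i ∈ range n, factor i (x + 1) (y + 1) := by
        rcases x with _ | x
        · rw [det_entryMatrix_of_neg_left _ _ _ (by simp)]
          simp [factorDiff]
        rcases y with _ | y
        · rw [det_entryMatrix_of_neg_right _ _ ((0 : ℕ) - 1) (by simp)]
          simp [factorDiff]
        rw [← prod_factor_mul_prod_factor, ← ih (n + 1) (by omega) (x + 3) y (by omega),
          ← ih (n + 1) (by omega) x (y + 3) (by omega), mul_comm]
        push_cast
        congr! 3 <;> ring
      rw [hc, h₁, h₂, hoff, ← factor_sub_factor] at key
      apply mul_right_cancel₀ hne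
      rw [key, prod_range_succ _ (n + 1), prod_range_succ (fun i => factor i (x + 1) (y + 1))]
      ring

lemma choose_add_choose (p q : ℕ) (h : 1 ≤ p + q) :
    ((ibinom ((p : ℤ) + q) p + ibinom ((p : ℤ) + q - 1) (p - 1) : ℤ) : ℚ) =
      (2 * p + q) * ((p + q - 1).factorial / (q.factorial * p.factorial)) := by
  rcases p with _ | p
  · obtain ⟨q, rfl⟩ : ∃ r, q = r + 1 := ⟨q - 1, by omega⟩
    have : (0 : ℤ) ≤ q + 1 := by positivity
    simp [ibinom, Nat.factorial_succ, this]
    field_simp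
  · have h₁ : ibinom (((p + 1 : ℕ) : ℤ) + q) (p + 1 : ℕ) = (p + 1 + q).choose (p + 1) := by
      rw [ibinom, if_pos (by omega), Int.toNat_natCast]
      norm_cast
    have h₂ : ibinom (((p + 1 : ℕ) : ℤ) + q - 1) ((p + 1 : ℕ) - 1) = (p + q).choose p := by
      rw [ibinom, if_pos (by omega), show (((p + 1 : ℕ) : ℤ) + q - 1).toNat = p + q by omega,
        show (((p + 1 : ℕ) : ℤ) - 1).toNat = p by omega]
    rw [h₁, h₂, show p + 1 + q - 1 = p + q by omega]
    push_cast
    rw [Nat.cast_add_choose, Nat.cast_add_choose, show p + 1 + q = p + q + 1 by omega,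
      Nat.factorial_succ (p + q), Nat.factorial_succ p]
    push_cast
    field_simp
    ring

lemma ibinom_add_ibinom (x y i j : ℕ) (h : 1 ≤ x + y) :
    ((ibinom ((x : ℤ) + y + i + j) ((y : ℤ) + 2 * j - i) +
        ibinom ((x : ℤ) + y + i + j - 1) ((y : ℤ) + 2 * j - i - 1) : ℤ) : ℚ) =
      (x + 2 * y + 3 * j) * entry x y i j := by
  unfold entry rfact
  by_cases hp : 0 ≤ (y : ℤ) + 2 * j - i
  · by_cases hq : 0 ≤ (x : ℤ) + 2 * i - j
    · obtain ⟨p, hp'⟩ := Int.eq_ofNat_of_zero_le hp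
      obtain ⟨q, hq'⟩ := Int.eq_ofNat_of_zero_le hq
      rw [if_pos hp, if_pos hq, hp', hq', show (x : ℤ) + y + i + j = p + q by omega,
        choose_add_choose p q (by omega), show ((p : ℤ) + q - 1).toNat = p + q - 1 by omega,
        Int.toNat_natCast, Int.toNat_natCast]
      have : (x : ℚ) + 2 * y + 3 * j = 2 * p + q := by
        exact_mod_cast (by omega : (x : ℤ) + 2 * y + 3 * j = 2 * p + q)
      rw [this]
      field_simp
    · rw [if_neg hq, ibinom, if_neg (by omega), ibinom, if_neg (by omega)]
      simp
  · rw [if_neg hp, ibinom, if_neg (by omega), ibinom, if_neg (by omega)]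
    simp

lemma poch_eq_factorial_div (a k : ℕ) (h : 1 ≤ a) :
    poch a k = ((a + k - 1).factorial : ℚ) / (a - 1).factorial := by
  obtain ⟨b, rfl⟩ : ∃ b, a = b + 1 := ⟨a - 1, by omega⟩
  simp only [poch, show b + 1 + k - 1 = b + k by omega, Nat.add_sub_cancel]
  rw [eq_div_iff (by positivity)]
  induction k with
  | zero => simp
  | succ k ih =>
    rw [prod_range_succ, mul_right_comm, ih, show b + (k + 1) = b + k + 1 by omega,
      Nat.factorial_succ (b + k)]
    push_cast
    ring

/-- Theorem 10, equation (5.4). -/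
theorem thm10_54 (x y n : ℕ) (h : 1 ≤ x + y) :
    Matrix.det (Matrix.of fun i j : Fin n =>
        ((ibinom ((x : ℤ) + y + (i : ℕ) + (j : ℕ)) ((y : ℤ) + 2 * (j : ℕ) - (i : ℕ)) +
            ibinom ((x : ℤ) + y + (i : ℕ) + (j : ℕ) - 1)
              ((y : ℤ) + 2 * (j : ℕ) - (i : ℕ) - 1) : ℤ) : ℚ)) =
      ∏ i ∈ Finset.range n,
        ((Nat.factorial i : ℚ) * (Nat.factorial (x + y + i - 1) : ℚ) *
            poch (2 * x + y + 2 * i : ℚ) i * poch (x + 2 * y + 2 * i : ℚ) (i + 1) /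
          ((Nat.factorial (x + 2 * i) : ℚ) * (Nat.factorial (y + 2 * i) : ℚ))) := by
  have hM : (Matrix.of fun i j : Fin n =>
        ((ibinom ((x : ℤ) + y + (i : ℕ) + (j : ℕ)) ((y : ℤ) + 2 * (j : ℕ) - (i : ℕ)) +
            ibinom ((x : ℤ) + y + (i : ℕ) + (j : ℕ) - 1)
              ((y : ℤ) + 2 * (j : ℕ) - (i : ℕ) - 1) : ℤ) : ℚ)) =
      Matrix.of fun i j : Fin n => (x + 2 * y + 3 * (j : ℕ) : ℚ) * entryMatrix n x y i j := by
    ext i j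
    exact ibinom_add_ibinom x y i j h
  rw [hM, det_mul_row (fun j : Fin n => (x + 2 * y + 3 * (j : ℕ) : ℚ)), det_entryMatrix n x y h,
    ← prod_range (fun j => (x + 2 * y + 3 * j : ℚ)), ← prod_mul_distrib]
  refine prod_congr rfl fun i _ => ?_
  have h₁ := poch_eq_factorial_div (2 * x + y + 2 * i) i (by omega)
  have h₂ := poch_eq_factorial_div (x + 2 * y + 2 * i) (i + 1) (by omega)
  rw [show 2 * x + y + 2 * i + i - 1 = 2 * x + y + 3 * i - 1 by omega] at h₁
  rw [show x + 2 * y + 2 * i + (i + 1) - 1 = x + 2 * y + 3 * i - 1 + 1 by omega,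
    Nat.factorial_succ, show x + 2 * y + 3 * i - 1 + 1 = x + 2 * y + 3 * i by omega] at h₂
  push_cast at h₁ h₂
  rw [h₁, h₂, factor]
  field_simp
end

section
/- Let x, n be nonnegative integers with n ≥ 1. Then E(x,x+1;n) = (n!/⌊n/2⌋!) · ∏_{i=0}^{n−1} [ i! · (2x+i)! · (3x+2i+2)_i · (3x+2i+3)_i / ((x+2i+1)! · (x+2i+2)!) ] · (x+1)_{⌊n/2⌋}. (Corollary 6, case m=1) -/
open Finset

/-- The Desnanot–Jacobi identity (Dodgson condensation), when the interior minor is nonzero. -/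
theorem det_mul_det_interior {K : Type*} [Field K] {n : ℕ}
    (M : Matrix (Fin (n + 2)) (Fin (n + 2)) K)
    (h : (M.submatrix (fun i : Fin n => i.succ.castSucc)
      (fun i : Fin n => i.succ.castSucc)).det ≠ 0) :
    M.det * (M.submatrix (fun i : Fin n => i.succ.castSucc)
        (fun i : Fin n => i.succ.castSucc)).det =
      (M.submatrix Fin.castSucc Fin.castSucc).det * (M.submatrix Fin.succ Fin.succ).det -
      (M.submatrix Fin.succ Fin.castSucc).det * (M.submatrix Fin.castSucc Fin.succ).det := by
  set C := M.submatrix (fun i : Fin n => i.succ.castSucc) (fun i : Fin n => i.succ.castSucc)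
    with hC
  have : Invertible C := C.invertibleOfIsUnitDet (isUnit_iff_ne_zero.mpr h)
  let corner : Fin 2 → Fin (n + 2) := ![0, Fin.last (n + 1)]
  let schur : Fin (n + 2) → Fin (n + 2) → K := fun a b =>
    M a b - ((M.submatrix (fun _ : Unit => a) (fun i : Fin n => i.succ.castSucc)) * ⅟C *
      (M.submatrix (fun i : Fin n => i.succ.castSucc) (fun _ : Unit => b))) () ()
  have bordered (a b : Fin (n + 2)) :
      (M.submatrix (Sum.elim (fun i : Fin n => i.succ.castSucc) (fun _ : Unit => a))
        (Sum.elim (fun i : Fin n => i.succ.castSucc) (fun _ : Unit => b))).det =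
        C.det * schur a b := by
    rw [← Matrix.fromBlocks_toBlocks (M.submatrix _ _)]
    change (Matrix.fromBlocks C _ _ _).det = _
    rw [Matrix.det_fromBlocks₁₁, Matrix.det_unique (n := Unit)]
    rfl
  obtain ⟨e, he⟩ : ∃ e : Fin n ⊕ Fin 2 ≃ Fin (n + 2),
      ⇑e = Sum.elim (fun i : Fin n => i.succ.castSucc) corner := by
    refine ⟨Equiv.ofBijective _ ((Fintype.bijective_iff_injective_and_card _).mpr ⟨?_, by simp⟩),
      rfl⟩
    rintro (a | a) (b | b) hab
    · simpa [Fin.ext_iff] using hab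
    · fin_cases b <;> simp [corner, Fin.ext_iff] at hab
      omega
    · fin_cases a <;> simp [corner, Fin.ext_iff] at hab
      omega
    · fin_cases a <;> fin_cases b <;> simp [corner, Fin.ext_iff] at hab ⊢
  obtain ⟨p, hp⟩ : ∃ p : Fin n ⊕ Unit ≃ Fin (n + 1),
      ⇑p = Sum.elim Fin.castSucc (fun _ => Fin.last n) := by
    refine ⟨Equiv.ofBijective _ ((Fintype.bijective_iff_injective_and_card _).mpr ⟨?_, by simp⟩),
      rfl⟩
    rintro (a | a) (b | b) hab <;> simp [Fin.ext_iff] at hab ⊢ <;> omega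
  obtain ⟨q, hq⟩ : ∃ q : Fin n ⊕ Unit ≃ Fin (n + 1),
      ⇑q = Sum.elim Fin.succ (fun _ => 0) := by
    refine ⟨Equiv.ofBijective _ ((Fintype.bijective_iff_injective_and_card _).mpr ⟨?_, by simp⟩),
      rfl⟩
    rintro (a | a) (b | b) hab <;> simp [Fin.ext_iff] at hab ⊢
    omega
  have hcs : Fin.castSucc ∘ q = Sum.elim (fun i : Fin n => i.succ.castSucc) (fun _ => 0) := by
    rw [hq]; ext (a | a) <;> simp
  have hsp : Fin.succ ∘ p =
      Sum.elim (fun i : Fin n => i.succ.castSucc) (fun _ => Fin.last (n + 1)) := by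
    rw [hp]; ext (a | a) <;> simp
  have hM : M.det = C.det *
      (schur 0 0 * schur (Fin.last _) (Fin.last _) -
        schur 0 (Fin.last _) * schur (Fin.last _) 0) := by
    rw [← Matrix.det_submatrix_equiv_self e M, he, ← Matrix.fromBlocks_toBlocks (M.submatrix _ _)]
    change (Matrix.fromBlocks C _ _ _).det = _
    rw [Matrix.det_fromBlocks₁₁, Matrix.det_fin_two]
    rfl
  have h00 : (M.submatrix Fin.castSucc Fin.castSucc).det = C.det * schur 0 0 := by
    rw [← Matrix.det_submatrix_equiv_self q, Matrix.submatrix_submatrix, hcs, bordered]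
  have hll : (M.submatrix Fin.succ Fin.succ).det =
      C.det * schur (Fin.last _) (Fin.last _) := by
    rw [← Matrix.det_submatrix_equiv_self p, Matrix.submatrix_submatrix, hsp, bordered]
  have hl0 : (Equiv.Perm.sign (p.symm.trans q) : K) * (M.submatrix Fin.succ Fin.castSucc).det =
      C.det * schur (Fin.last _) 0 := by
    rw [← bordered, ← hsp, ← hcs, ← Matrix.det_permute', ← Matrix.det_submatrix_equiv_self p]
    congr 1
    ext i j
    simp
  have h0l : (Equiv.Perm.sign (p.symm.trans q) : K) * (M.submatrix Fin.castSucc Fin.succ).det =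
      C.det * schur 0 (Fin.last _) := by
    rw [← bordered, ← hsp, ← hcs, ← Matrix.det_permute, ← Matrix.det_submatrix_equiv_self p]
    congr 1
    ext i j
    simp
  have hs : (Equiv.Perm.sign (p.symm.trans q) : K) * (Equiv.Perm.sign (p.symm.trans q) : K) = 1 := by
    rcases Int.units_eq_one_or (Equiv.Perm.sign (p.symm.trans q)) with h | h <;> simp [h]
  have hoff : (M.submatrix Fin.succ Fin.castSucc).det * (M.submatrix Fin.castSucc Fin.succ).det =
      (C.det * schur (Fin.last _) 0) * (C.det * schur 0 (Fin.last _)) := by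
    rw [← hl0, ← h0l]
    linear_combination (-(M.submatrix Fin.succ Fin.castSucc).det *
      (M.submatrix Fin.castSucc Fin.succ).det) * hs
  rw [hM, h00, hll, hoff]
  ring

/-- The polynomials with exponential generating function `(1 + t) ^ (-x) * (1 - t) ^ (-y)`. -/
noncomputable def egfPoly (x y : ℝ) : ℕ → ℝ
  | 0 => 1
  | 1 => y - x
  | n + 2 => (y - x) * egfPoly x y (n + 1) + (n + 1) * (x + y + n) * egfPoly x y n

theorem egfPoly_add_two (x y : ℝ) (n : ℕ) : egfPoly x y (n + 2) =
    (y - x) * egfPoly x y (n + 1) + (n + 1) * (x + y + n) * egfPoly x y n := by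
  rw [egfPoly]

theorem egfPoly_swap (x y : ℝ) (n : ℕ) : egfPoly y x n = (-1) ^ n * egfPoly x y n := by
  induction n using Nat.twoStepInduction with
  | zero => simp [egfPoly]
  | one => simp [egfPoly]
  | more n ih1 ih2 =>
    rw [egfPoly_add_two, egfPoly_add_two, ih1, ih2]
    ring

theorem egfPoly_pos {x y : ℝ} (hxy : x < y) (h : 0 < x + y) (n : ℕ) : 0 < egfPoly x y n := by
  induction n using Nat.twoStepInduction with
  | zero => simp [egfPoly]
  | one => simpa [egfPoly] using hxy
  | more n ih1 ih2 =>
    have := sub_pos.mpr hxy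
    rw [egfPoly_add_two]
    positivity

theorem egfPoly_ne_zero {x y : ℝ} (hxy : x ≠ y) (h : 0 < x + y) (n : ℕ) :
    egfPoly x y n ≠ 0 := by
  rcases lt_or_gt_of_ne hxy with hlt | hlt
  · exact (egfPoly_pos hlt h n).ne'
  · rw [egfPoly_swap y x]
    exact mul_ne_zero (by simp) (egfPoly_pos hlt (by linarith) n).ne'

theorem egfPoly_left_succ (x y : ℝ) (n : ℕ) :
    egfPoly (x + 1) y (n + 1) + (n + 1) * egfPoly (x + 1) y n = egfPoly x y (n + 1) := by
  induction n using Nat.twoStepInduction with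
  | zero => simp [egfPoly]; ring
  | one => simp [egfPoly]; ring
  | more n ih1 ih2 =>
    rw [egfPoly_add_two x, ← ih1, ← ih2, egfPoly_add_two _ _ (n + 1), egfPoly_add_two _ _ n]
    push_cast
    ring

theorem egfPoly_right_succ (x y : ℝ) (n : ℕ) :
    egfPoly x (y + 1) (n + 1) - (n + 1) * egfPoly x (y + 1) n = egfPoly x y (n + 1) := by
  have := egfPoly_left_succ y x n
  rw [egfPoly_swap x (y + 1), egfPoly_swap x (y + 1), egfPoly_swap x y] at this
  have h : ((-1 : ℝ) ^ n) ≠ 0 := by simp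
  apply mul_left_cancel₀ h
  linear_combination -this

theorem two_mul_egfPoly_left_succ (x y : ℝ) (n : ℕ) :
    2 * x * egfPoly (x + 1) y n = (n + x + y) * egfPoly x y n - egfPoly x y (n + 1) := by
  cases n with
  | zero => simp [egfPoly]; ring
  | succ n =>
    rw [← egfPoly_left_succ x y (n + 1), ← egfPoly_left_succ x y n, egfPoly_add_two]
    push_cast
    ring

theorem two_mul_egfPoly_right_succ (x y : ℝ) (n : ℕ) :
    2 * y * egfPoly x (y + 1) n = (n + x + y) * egfPoly x y n + egfPoly x y (n + 1) := by
  have := two_mul_egfPoly_left_succ y x n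
  rw [egfPoly_swap x (y + 1), egfPoly_swap x y, egfPoly_swap x y] at this
  have h : ((-1 : ℝ) ^ n) ≠ 0 := by simp
  apply mul_left_cancel₀ h
  linear_combination this

theorem egfPoly_condensation {x y : ℝ} (hx : x + 1 ≠ 0) (hy : y + 1 ≠ 0) (n : ℕ)
    (hn : x + y + n + 1 ≠ 0) :
    (n + 1) * (2 * x + y + 2 * n + 3) * (x + 2 * y + 2 * n + 3) *
        (egfPoly x y (n + 2) * egfPoly (x + 1) (y + 1) n) =
      (x + y + n + 1) * (x + 2 * n + 3) * (y + 2 * n + 3) *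
        (egfPoly x y (n + 1) * egfPoly (x + 1) (y + 1) (n + 1)) -
      (x + y) * (x + 1) * (y + 1) *
        (egfPoly (x + 2) (y - 1) (n + 1) * egfPoly (x - 1) (y + 2) (n + 1)) := by
  have a1 := egfPoly_left_succ x (y + 1) n
  have a2 := egfPoly_left_succ x (y + 1) (n + 1)
  have a3 := egfPoly_right_succ x y n
  have a4 := egfPoly_right_succ x y (n + 1)
  have a5 := two_mul_egfPoly_left_succ x (y + 1) n
  have b1 := egfPoly_right_succ (x + 1) y n
  have b2 := egfPoly_right_succ (x + 1) y (n + 1)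
  have b5 := two_mul_egfPoly_right_succ (x + 1) y n
  have c1 := egfPoly_right_succ (x + 2) (y - 1) n
  have c2 := two_mul_egfPoly_left_succ (x + 1) y n
  have c3 := two_mul_egfPoly_left_succ (x + 1) y (n + 1)
  have d1 := egfPoly_left_succ (x - 1) (y + 2) n
  have d2 := two_mul_egfPoly_right_succ x (y + 1) n
  have d3 := two_mul_egfPoly_right_succ x (y + 1) (n + 1)
  have r := egfPoly_add_two (x + 1) (y + 1) n
  rw [show x + 1 + 1 = x + 2 by ring] at c2 c3
  rw [show y + 1 + 1 = y + 2 by ring] at d2 d3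
  rw [show y - 1 + 1 = y by ring] at c1
  rw [show x - 1 + 1 = x by ring] at d1
  push_cast at *
  generalize egfPoly (x + 1) (y + 1) n = u at *
  generalize egfPoly (x + 1) (y + 1) (n + 1) = v at *
  generalize egfPoly x (y + 1) n = s0 at *
  generalize egfPoly x (y + 1) (n + 1) = s1 at *
  generalize egfPoly (x + 1) y n = r0 at *
  generalize egfPoly (x + 1) y (n + 1) = r1 at *
  generalize egfPoly (x + 2) y n = q0 at *
  generalize egfPoly (x + 2) y (n + 1) = q1 at *
  generalize egfPoly x (y + 2) n = p0 at *
  generalize egfPoly x (y + 2) (n + 1) = p1 at *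
  rw [← a4, ← a3, ← c1, ← d1, ← a2, r]
  rw [← b2, r, ← b1] at c3
  rw [← b1] at c2 b5
  rw [← a2, r, ← a1] at d3
  rw [← a1] at d2 a5 ⊢
  have hr : r0 = (2 * y * u - (v - (n + 1) * u)) / (x + y + n + 1) := by
    field_simp; linear_combination -b5
  have hs : s0 = (2 * x * u + (v + (n + 1) * u)) / (x + y + n + 1) := by
    field_simp; linear_combination -a5
  have hq0 : q0 = ((n + (x + 1) + y) * r0 - (v - (n + 1) * u)) / (2 * (x + 1)) := by
    field_simp; linear_combination c2
  have hq1 : q1 = ((n + 1 + (x + 1) + y) * (v - (n + 1) * u) -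
      ((y + 1 - (x + 1)) * v + (n + 1) * (x + 1 + (y + 1) + n) * u - (n + 1 + 1) * v)) /
      (2 * (x + 1)) := by
    field_simp; linear_combination c3
  have hp0 : p0 = ((n + x + (y + 1)) * s0 + (v + (n + 1) * u)) / (2 * (y + 1)) := by
    field_simp; linear_combination d2
  have hp1 : p1 = ((n + 1 + x + (y + 1)) * (v + (n + 1) * u) +
      ((y + 1 - (x + 1)) * v + (n + 1) * (x + 1 + (y + 1) + n) * u + (n + 1 + 1) * v)) /
      (2 * (y + 1)) := by
    field_simp; linear_combination d3
  rw [hq1, hq0, hp1, hp0, hr, hs]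
  field_simp
  ring

theorem egfPoly_two_mul (x : ℝ) (k : ℕ) :
    egfPoly x (x + 1) (2 * k) =
        (2 * k).factorial / k.factorial * ∏ i ∈ range k, (x + 1 + i) ∧
      egfPoly x (x + 1) (2 * k + 1) =
        (2 * k + 1).factorial / k.factorial * ∏ i ∈ range k, (x + 1 + i) := by
  induction k with
  | zero => simp [egfPoly]
  | succ k ih =>
    have h1 : egfPoly x (x + 1) (2 * (k + 1)) = (2 * (k + 1)).factorial / (k + 1).factorial *
        ∏ i ∈ range (k + 1), (x + 1 + i) := by
      rw [show 2 * (k + 1) = 2 * k + 2 by ring, egfPoly_add_two, ih.1, ih.2, prod_range_succ]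
      simp only [Nat.factorial_succ]
      push_cast
      field_simp
      ring
    refine ⟨h1, ?_⟩
    rw [show 2 * (k + 1) + 1 = (2 * k + 1) + 2 by ring, egfPoly_add_two,
      show 2 * k + 1 + 1 = 2 * (k + 1) by ring, h1, ih.2, prod_range_succ,
      show 2 * k + 1 + 2 = 2 * k + 1 + 1 + 1 by ring, show 2 * (k + 1) = 2 * k + 1 + 1 by ring]
    simp only [Nat.factorial_succ]
    push_cast
    field_simp
    ring

theorem egfPoly_self_add_one (x : ℝ) (n : ℕ) : egfPoly x (x + 1) n =
    n.factorial / (n / 2).factorial * ∏ i ∈ range (n / 2), (x + 1 + i) := by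
  obtain ⟨k, rfl | rfl⟩ := n.even_or_odd'
  · rw [(egfPoly_two_mul x k).1, Nat.mul_div_cancel_left k two_pos]
  · rw [(egfPoly_two_mul x k).2, show (2 * k + 1) / 2 = k by omega]

/-- The entries of `Edet`, with factorials replaced by the Gamma function. -/
noncomputable def gammaEntry (x y i j : ℝ) : ℝ :=
  Real.Gamma (x + y + i + j) * (y - x + 3 * j - 3 * i) *
    (Real.Gamma (x + 2 * i - j + 2))⁻¹ * (Real.Gamma (y + 2 * j - i + 2))⁻¹

/-- The real interpolation of `Edet`. -/
noncomputable def gammaDet (x y : ℝ) (n : ℕ) : ℝ :=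
  Matrix.det (Matrix.of fun i j : Fin n => gammaEntry x y (i : ℕ) (j : ℕ))

/-- The factors of the product in the evaluation of `gammaDet`, see `gammaDet_eq`. -/
noncomputable def gammaFactor (x y : ℝ) (n : ℕ) : ℝ :=
  n.factorial * Real.Gamma (x + y + n) * (∏ i ∈ range n, (2 * x + y + 2 * n + 1 + i)) *
    (∏ i ∈ range n, (x + 2 * y + 2 * n + 1 + i)) *
    (Real.Gamma (x + 2 * n + 2))⁻¹ * (Real.Gamma (y + 2 * n + 2))⁻¹

theorem gammaDet_condensation (x y : ℝ) (n : ℕ) (h : gammaDet (x + 1) (y + 1) n ≠ 0) :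
    gammaDet x y (n + 2) * gammaDet (x + 1) (y + 1) n =
      gammaDet x y (n + 1) * gammaDet (x + 1) (y + 1) (n + 1) -
      gammaDet (x + 2) (y - 1) (n + 1) * gammaDet (x - 1) (y + 2) (n + 1) := by
  have hsub {k : ℕ} (a b : ℕ) (u v : ℝ) (f g : Fin k → Fin (n + 2))
      (hf : ∀ i, (f i : ℕ) = i + a) (hg : ∀ i, (g i : ℕ) = i + b)
      (hx : u = x + 2 * a - b) (hy : v = y + 2 * b - a) :
      gammaDet u v k = ((Matrix.of fun i j : Fin (n + 2) =>
        gammaEntry x y (i : ℕ) (j : ℕ)).submatrix f g).det := by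
    rw [gammaDet]
    congr 1
    ext i j
    simp only [Matrix.of_apply, Matrix.submatrix_apply, gammaEntry, hf, hg, hx, hy]
    push_cast
    congr 3 <;> ring_nf
  have h11 := hsub 1 1 (x + 1) (y + 1) (fun i : Fin n => i.succ.castSucc)
    (fun i : Fin n => i.succ.castSucc) (by simp) (by simp) (by push_cast; ring)
    (by push_cast; ring)
  rw [h11, hsub 0 0 x y Fin.castSucc Fin.castSucc (by simp) (by simp) (by simp) (by simp),
    hsub 1 1 (x + 1) (y + 1) Fin.succ Fin.succ (by simp) (by simp) (by push_cast; ring)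
      (by push_cast; ring),
    hsub 1 0 (x + 2) (y - 1) Fin.succ Fin.castSucc (by simp) (by simp) (by push_cast; ring)
      (by push_cast; ring),
    hsub 0 1 (x - 1) (y + 2) Fin.castSucc Fin.succ (by simp) (by simp) (by push_cast; ring)
      (by push_cast; ring)]
  exact det_mul_det_interior _ (h11 ▸ h)

theorem gammaFactor_succ {x y : ℝ} (hx : Irrational x) (hy : Irrational y) (hxy : 0 < x + y)
    (n : ℕ) :
    (n + 1) * (2 * x + y + 2 * n + 3) * (x + 2 * y + 2 * n + 3) * gammaFactor (x + 1) (y + 1) n =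
      (x + y + n + 1) * (x + 2 * n + 3) * (y + 2 * n + 3) * gammaFactor x y (n + 1) := by
  have hx3 : x + 2 * n + 3 ≠ 0 := by simpa using ((hx.add_natCast (2 * n)).add_natCast 3).ne_zero
  have hy3 : y + 2 * n + 3 ≠ 0 := by simpa using ((hy.add_natCast (2 * n)).add_natCast 3).ne_zero
  have hs : x + y + n + 1 ≠ 0 := by positivity
  have g1 := Real.Gamma_add_one hx3
  have g2 := Real.Gamma_add_one hy3
  have g3 := Real.Gamma_add_one hs
  simp only [gammaFactor, prod_range_succ', Nat.factorial_succ]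
  push_cast
  rw [show x + 2 * (n + 1 : ℝ) + 2 = x + 2 * n + 3 + 1 by ring,
    show y + 2 * (n + 1 : ℝ) + 2 = y + 2 * n + 3 + 1 by ring, g1, g2,
    show x + 1 + (y + 1) + n = x + y + n + 1 + 1 by ring, g3,
    show x + 1 + 2 * (n : ℝ) + 2 = x + 2 * n + 3 by ring,
    show y + 1 + 2 * (n : ℝ) + 2 = y + 2 * n + 3 by ring,
    show x + y + (n + 1 : ℝ) = x + y + n + 1 by ring]
  have p1 : ∏ i ∈ range n, (2 * (x + 1) + (y + 1) + 2 * n + 1 + (i : ℝ)) =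
      ∏ i ∈ range n, (2 * x + y + 2 * (n + 1) + 1 + ((i : ℝ) + 1)) :=
    prod_congr rfl fun i _ => by ring
  have p2 : ∏ i ∈ range n, (x + 1 + 2 * (y + 1) + 2 * n + 1 + (i : ℝ)) =
      ∏ i ∈ range n, (x + 2 * y + 2 * (n + 1) + 1 + ((i : ℝ) + 1)) :=
    prod_congr rfl fun i _ => by ring
  rw [p1, p2, mul_inv, mul_inv]
  generalize (Real.Gamma (x + 2 * n + 3))⁻¹ = a
  generalize (Real.Gamma (y + 2 * n + 3))⁻¹ = b
  generalize ∏ i ∈ range n, (2 * x + y + 2 * (n + 1) + 1 + ((i : ℝ) + 1)) = c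
  generalize ∏ i ∈ range n, (x + 2 * y + 2 * (n + 1) + 1 + ((i : ℝ) + 1)) = d
  generalize x + 2 * (n : ℝ) + 3 = x₃ at *
  generalize y + 2 * (n : ℝ) + 3 = y₃ at *
  field_simp
  ring

theorem gammaFactor_shift {x y : ℝ} (hx : Irrational x) (hy : Irrational y) (hxy : 0 < x + y)
    (n : ℕ) :
    gammaFactor (x + 2) (y - 1) n * gammaFactor (x - 1) (y + 2) n *
        ((x + y + n + 1) * (x + 2 * n + 3) * (y + 2 * n + 3)) =
      (x + y + n) * (x + 2 * n + 1) * (y + 2 * n + 1) *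
        (gammaFactor x y n * gammaFactor (x + 1) (y + 1) n) := by
  have hx' (k : ℕ) : x + 2 * n + k ≠ 0 := by
    simpa using ((hx.add_natCast (2 * n)).add_natCast k).ne_zero
  have hy' (k : ℕ) : y + 2 * n + k ≠ 0 := by
    simpa using ((hy.add_natCast (2 * n)).add_natCast k).ne_zero
  have hs : x + y + n ≠ 0 := by positivity
  have hx1 : x + 2 * n + 1 ≠ 0 := by simpa using hx' 1
  have hx2 : x + 2 * n + 1 + 1 ≠ 0 := by simpa [add_assoc, one_add_one_eq_two] using hx' 2
  have hx3 : x + 2 * n + 1 + 1 + 1 ≠ 0 := by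
    convert hx' 3 using 1; push_cast; ring
  have hy1 : y + 2 * n + 1 ≠ 0 := by simpa using hy' 1
  have hy2 : y + 2 * n + 1 + 1 ≠ 0 := by simpa [add_assoc, one_add_one_eq_two] using hy' 2
  have hy3 : y + 2 * n + 1 + 1 + 1 ≠ 0 := by
    convert hy' 3 using 1; push_cast; ring
  have hs1 : x + y + n + 1 ≠ 0 := by positivity
  simp only [gammaFactor]
  rw [show x + 2 + (y - 1) + n = x + y + n + 1 by ring,
    show x - 1 + (y + 2) + n = x + y + n + 1 by ring,
    show x + 1 + (y + 1) + n = x + y + n + 1 + 1 by ring,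
    Real.Gamma_add_one hs1, Real.Gamma_add_one hs,
    show x + 2 + 2 * (n : ℝ) + 2 = x + 2 * n + 1 + 1 + 1 + 1 by ring,
    show x + 1 + 2 * (n : ℝ) + 2 = x + 2 * n + 1 + 1 + 1 by ring,
    show x - 1 + 2 * (n : ℝ) + 2 = x + 2 * n + 1 by ring,
    show x + 2 * (n : ℝ) + 2 = x + 2 * n + 1 + 1 by ring,
    show y + 2 + 2 * (n : ℝ) + 2 = y + 2 * n + 1 + 1 + 1 + 1 by ring,
    show y + 1 + 2 * (n : ℝ) + 2 = y + 2 * n + 1 + 1 + 1 by ring,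
    show y - 1 + 2 * (n : ℝ) + 2 = y + 2 * n + 1 by ring,
    show y + 2 * (n : ℝ) + 2 = y + 2 * n + 1 + 1 by ring,
    Real.Gamma_add_one hx3, Real.Gamma_add_one hx2, Real.Gamma_add_one hx1,
    Real.Gamma_add_one hy3, Real.Gamma_add_one hy2, Real.Gamma_add_one hy1,
    show 2 * (x + 2) + (y - 1) = 2 * (x + 1) + (y + 1) by ring,
    show 2 * (x - 1) + (y + 2) = 2 * x + y by ring,
    show x - 1 + 2 * (y + 2) = x + 1 + 2 * (y + 1) by ring,
    show x + 2 + 2 * (y - 1) = x + 2 * y by ring]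
  simp only [mul_inv]
  have hx3' : x + 2 * n + 3 = x + 2 * n + 1 + 1 + 1 := by ring
  have hy3' : y + 2 * n + 3 = y + 2 * n + 1 + 1 + 1 := by ring
  rw [hx3', hy3']
  generalize ∏ i ∈ range n, (2 * (x + 1) + (y + 1) + 2 * (n : ℝ) + 1 + i) = a
  generalize ∏ i ∈ range n, (2 * x + y + 2 * (n : ℝ) + 1 + i) = b
  generalize ∏ i ∈ range n, (x + 1 + 2 * (y + 1) + 2 * (n : ℝ) + 1 + i) = c
  generalize ∏ i ∈ range n, (x + 2 * y + 2 * (n : ℝ) + 1 + i) = d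
  generalize (Real.Gamma (x + 2 * n + 1))⁻¹ = gx
  generalize (Real.Gamma (y + 2 * n + 1))⁻¹ = gy
  generalize Real.Gamma (x + y + n) = g
  generalize x + 2 * (n : ℝ) + 1 + 1 + 1 = x₃ at *
  generalize x + 2 * (n : ℝ) + 1 + 1 = x₂ at *
  generalize x + 2 * (n : ℝ) + 1 = x₁ at *
  generalize y + 2 * (n : ℝ) + 1 + 1 + 1 = y₃ at *
  generalize y + 2 * (n : ℝ) + 1 + 1 = y₂ at *
  generalize y + 2 * (n : ℝ) + 1 = y₁ at *
  generalize x + y + (n : ℝ) + 1 = s₁ at *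
  generalize x + y + (n : ℝ) = s at *
  field_simp

theorem prod_gammaFactor_shift {x y : ℝ} (hx : Irrational x) (hy : Irrational y)
    (hxy : 0 < x + y) (n : ℕ) :
    ((∏ i ∈ range n, gammaFactor (x + 2) (y - 1) i) *
        ∏ i ∈ range n, gammaFactor (x - 1) (y + 2) i) *
        ((x + y + n) * (x + 2 * n + 1) * (y + 2 * n + 1)) =
      (x + y) * (x + 1) * (y + 1) *
        ((∏ i ∈ range n, gammaFactor x y i) * ∏ i ∈ range n, gammaFactor (x + 1) (y + 1) i) := by
  induction n with
  | zero => simp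
  | succ n ih =>
    have h := gammaFactor_shift hx hy hxy n
    have hx1 : x + 2 * n + 1 ≠ 0 := by
      simpa using ((hx.add_natCast (2 * n)).add_natCast 1).ne_zero
    have hy1 : y + 2 * n + 1 ≠ 0 := by
      simpa using ((hy.add_natCast (2 * n)).add_natCast 1).ne_zero
    have hs : x + y + n ≠ 0 := by positivity
    have hne : (x + y + n) * (x + 2 * n + 1) * (y + 2 * n + 1) ≠ 0 := by positivity
    apply mul_left_cancel₀ hne
    simp only [prod_range_succ]
    push_cast
    linear_combination (gammaFactor (x + 2) (y - 1) n * gammaFactor (x - 1) (y + 2) n *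
        ((x + y + n + 1) * (x + 2 * n + 3) * (y + 2 * n + 3))) * ih +
      (x + y) * (x + 1) * (y + 1) *
        ((∏ i ∈ range n, gammaFactor x y i) *
          ∏ i ∈ range n, gammaFactor (x + 1) (y + 1) i) * h

theorem Irrational.gamma_ne_zero {x : ℝ} (hx : Irrational x) : Real.Gamma x ≠ 0 :=
  Real.Gamma_ne_zero fun m => by simpa using hx.ne_int (-m)

theorem gammaFactor_ne_zero {x y : ℝ} (hx : Irrational x) (hy : Irrational y)
    (h1 : Irrational (2 * x + y)) (h2 : Irrational (x + 2 * y)) (hxy : 0 < x + y) (n : ℕ) :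
    gammaFactor x y n ≠ 0 := by
  have hg : Real.Gamma (x + y + n) ≠ 0 := (Real.Gamma_pos_of_pos (by positivity)).ne'
  have hgx : Real.Gamma (x + 2 * n + 2) ≠ 0 := by
    simpa using ((hx.add_natCast (2 * n)).add_natCast 2).gamma_ne_zero
  have hgy : Real.Gamma (y + 2 * n + 2) ≠ 0 := by
    simpa using ((hy.add_natCast (2 * n)).add_natCast 2).gamma_ne_zero
  have hp {z : ℝ} (hz : Irrational z) : ∏ i ∈ range n, (z + 2 * n + 1 + i) ≠ 0 :=
    prod_ne_zero_iff.mpr fun i _ => by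
      simpa using (((hz.add_natCast (2 * n)).add_natCast 1).add_natCast i).ne_zero
  simp [gammaFactor, hg, hgx, hgy, hp h1, hp h2, Nat.factorial_ne_zero]

theorem gammaDet_eq (n : ℕ) {x y : ℝ} (hx : Irrational x) (hxy : 0 < x + y)
    (hm : ∃ k : ℤ, y - x = 3 * k + 1) :
    gammaDet x y n = (∏ i ∈ range n, gammaFactor x y i) * egfPoly x y n := by
  induction n using Nat.strong_induction_on generalizing x y with
  | _ n ih =>
  match n with
  | 0 => simp [gammaDet, egfPoly]
  | 1 => simp [gammaDet, egfPoly, gammaEntry, gammaFactor]; ring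
  | n + 2 =>
    obtain ⟨k, hk⟩ := hm
    have hyk : y = x + (3 * k + 1 : ℤ) := by push_cast; linarith
    have hy : Irrational y := hyk ▸ hx.add_intCast _
    have hx3 : Irrational (3 * x) := by simpa using hx.natCast_mul three_ne_zero
    have hne : x ≠ y := by
      rintro rfl
      have : (0 : ℝ) = ((3 * k + 1 : ℤ) : ℝ) := by push_cast; linarith
      have : 0 = 3 * k + 1 := by exact_mod_cast this
      omega
    have hW : ∏ i ∈ range n, gammaFactor (x + 1) (y + 1) i ≠ 0 :=
      prod_ne_zero_iff.mpr fun i _ => gammaFactor_ne_zero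
        (by simpa using hx.add_natCast 1) (by simpa using hy.add_natCast 1)
        (by convert hx3.add_intCast (3 * k + 4) using 1; rw [hyk]; push_cast; ring)
        (by convert hx3.add_intCast (6 * k + 5) using 1; rw [hyk]; push_cast; ring)
        (by linarith) i
    have hS : egfPoly (x + 1) (y + 1) n ≠ 0 := egfPoly_ne_zero (by simpa) (by linarith) n
    have hx1 : Irrational (x + 1) := by simpa using hx.add_natCast 1
    have hy1 : Irrational (y + 1) := by simpa using hy.add_natCast 1
    have e0 := ih n (by omega) hx1 (y := y + 1) (by linarith) ⟨k, by linarith⟩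
    have e1 := ih (n + 1) (by omega) hx1 (y := y + 1) (by linarith) ⟨k, by linarith⟩
    have e2 := ih (n + 1) (by omega) hx hxy ⟨k, hk⟩
    have e3 := ih (n + 1) (by omega) (x := x + 2) (y := y - 1)
      (by simpa using hx.add_natCast 2) (by linarith) ⟨k - 1, by push_cast; linarith⟩
    have e4 := ih (n + 1) (by omega) (x := x - 1) (y := y + 2)
      (by simpa using hx.sub_natCast 1) (by linarith) ⟨k + 1, by push_cast; linarith⟩
    have hcond := gammaDet_condensation x y n (e0 ▸ mul_ne_zero hW hS)
    have hpoly := egfPoly_condensation hx1.ne_zero hy1.ne_zero n (by positivity)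
    have hfac := gammaFactor_succ hx hy hxy n
    have hprod := prod_gammaFactor_shift hx hy hxy (n + 1)
    rw [e0, e1, e2, e3, e4] at hcond
    have hc : (x + y + n + 1) * (x + 2 * n + 3) * (y + 2 * n + 3) ≠ 0 := by
      have hx3 : x + 2 * n + 3 ≠ 0 := by
        simpa using ((hx.add_natCast (2 * n)).add_natCast 3).ne_zero
      have hy3 : y + 2 * n + 3 ≠ 0 := by
        simpa using ((hy.add_natCast (2 * n)).add_natCast 3).ne_zero
      positivity
    apply mul_right_cancel₀ (mul_ne_zero hc (mul_ne_zero hW hS))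
    simp only [prod_range_succ _ (n + 1)]
    rw [prod_range_succ (gammaFactor (x + 1) (y + 1)) n] at hcond hprod
    push_cast at hprod
    generalize (∏ i ∈ range n, gammaFactor (x + 1) (y + 1) i) = W11 at *
    generalize (∏ i ∈ range (n + 1), gammaFactor x y i) = W at *
    generalize (∏ i ∈ range (n + 1), gammaFactor (x + 2) (y - 1) i) = W3 at *
    generalize (∏ i ∈ range (n + 1), gammaFactor (x - 1) (y + 2) i) = W4 at *
    generalize gammaFactor (x + 1) (y + 1) n = w at *
    generalize gammaFactor x y (n + 1) = w' at *
    generalize egfPoly (x + 2) (y - 1) (n + 1) = S3 at *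
    generalize egfPoly (x - 1) (y + 2) (n + 1) = S4 at *
    generalize egfPoly (x + 1) (y + 1) (n + 1) = S1 at *
    generalize egfPoly (x + 1) (y + 1) n = S0 at *
    linear_combination ((x + y + n + 1) * (x + 2 * n + 3) * (y + 2 * n + 3)) * hcond
      - S3 * S4 * hprod + W * W11 * w * (-hpoly) + W * W11 * egfPoly x y (n + 2) * S0 * hfac

theorem continuous_inv_gamma : Continuous fun x : ℝ => (Real.Gamma x)⁻¹ := by
  have h : Continuous fun x : ℝ => ((Complex.Gamma x)⁻¹).re :=
    Complex.continuous_re.comp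
      (Complex.differentiable_one_div_Gamma.continuous.comp Complex.continuous_ofReal)
  convert h using 2 with x
  rw [Complex.Gamma_ofReal, ← Complex.ofReal_inv, Complex.ofReal_re]

theorem continuous_egfPoly (n : ℕ) : Continuous fun x : ℝ => egfPoly x (x + 1) n := by
  simp only [egfPoly_self_add_one]
  fun_prop

theorem gammaDet_self_add_one {x : ℝ} (hx : 0 ≤ x) (n : ℕ) :
    gammaDet x (x + 1) n =
      (∏ i ∈ range n, gammaFactor x (x + 1) i) * egfPoly x (x + 1) n := by
  have hG (k : ℕ) : ContinuousOn (fun x : ℝ => Real.Gamma (x + (x + 1) + k))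
      (Set.Ioi (-(1 / 2))) := by
    intro x hx
    have hpos : 0 < x + (x + 1) + k := by
      have : -(1 / 2) < x := hx
      have := k.cast_nonneg (α := ℝ)
      linarith
    have hd : ContinuousAt Real.Gamma (x + (x + 1) + k) :=
      (Real.differentiableAt_Gamma fun m => by
        have := m.cast_nonneg (α := ℝ)
        linarith).continuousAt
    exact (ContinuousAt.comp' (f := fun x : ℝ => x + (x + 1) + k) hd
      (by fun_prop)).continuousWithinAt
  have hdet : ContinuousOn (fun x : ℝ => gammaDet x (x + 1) n) (Set.Ioi (-(1 / 2))) := by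
    have hentry (i j : ℕ) : ContinuousOn (fun x : ℝ => gammaEntry x (x + 1) i j)
        (Set.Ioi (-(1 / 2))) := by
      have hij : ContinuousOn (fun x : ℝ => Real.Gamma (x + (x + 1) + i + j))
          (Set.Ioi (-(1 / 2))) := by
        simpa only [Nat.cast_add, ← add_assoc] using hG (i + j)
      have hlin : Continuous fun x : ℝ => x + 1 - x + 3 * (j : ℝ) - 3 * i := by fun_prop
      refine ((hij.mul hlin.continuousOn).mul ?_).mul ?_ <;>
        exact (continuous_inv_gamma.comp (by fun_prop)).continuousOn
    rw [continuousOn_iff_continuous_domRestrict]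
    exact Continuous.matrix_det (continuous_matrix fun i j =>
      continuousOn_iff_continuous_domRestrict.mp (hentry i j))
  have hfac (i : ℕ) : ContinuousOn (fun x : ℝ => gammaFactor x (x + 1) i)
      (Set.Ioi (-(1 / 2))) := by
    refine (((((continuousOn_const.mul (hG i)).mul ?_).mul ?_).mul ?_).mul ?_)
    · fun_prop
    · fun_prop
    all_goals exact (continuous_inv_gamma.comp (by fun_prop)).continuousOn
  have heq : Set.EqOn (fun x : ℝ => gammaDet x (x + 1) n)
      (fun x => (∏ i ∈ range n, gammaFactor x (x + 1) i) * egfPoly x (x + 1) n)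
      (Set.Ioi (-(1 / 2)) ∩ {x | Irrational x}) := fun x ⟨h, hirr⟩ =>
    gammaDet_eq n hirr (by have : -(1 / 2) < x := h; linarith) ⟨0, by simp⟩
  exact heq.of_subset_closure hdet
    ((continuousOn_finsetProd _ fun i _ => hfac i).mul (continuous_egfPoly n).continuousOn)
    Set.inter_subset_left (dense_irrational.open_subset_closure_inter isOpen_Ioi)
    (show -(1 / 2) < x by linarith)

theorem rfac_cast (k : ℤ) (hk : 0 ≤ k) : (rfac k : ℝ) = Real.Gamma (k + 1) := by
  lift k to ℕ using hk
  simp [rfac, Real.Gamma_nat_eq_factorial]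

theorem rfacInv_cast (k : ℤ) : (rfacInv k : ℝ) = (Real.Gamma (k + 1))⁻¹ := by
  rcases lt_or_ge k 0 with hk | hk
  · obtain ⟨m, rfl⟩ : ∃ m : ℕ, k = -(m + 1) := ⟨(-k - 1).toNat, by omega⟩
    have h : ((-(m + 1) : ℤ) : ℝ) + 1 = -m := by push_cast; ring
    rw [h, Real.Gamma_neg_nat_eq_zero, rfacInv, if_neg (by omega)]
    simp
  · lift k to ℕ using hk
    simp [rfacInv, Real.Gamma_nat_eq_factorial]

theorem Edet_cast (x n : ℕ) : (Edet x (x + 1) n : ℝ) = gammaDet x (x + 1) n := by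
  rw [Edet, gammaDet, ← Rat.coe_castHom, RingHom.map_det]
  congr 1
  ext i j
  simp only [RingHom.mapMatrix_apply, Matrix.map_apply, Matrix.of_apply,
    Rat.coe_castHom, Rat.cast_mul, gammaEntry, rfacInv_cast]
  rw [rfac_cast _ (by push_cast; omega)]
  push_cast
  congr 3 <;> ring_nf

theorem gammaFactor_natCast (x i : ℕ) : gammaFactor x (x + 1) i =
    (((i.factorial : ℚ) * ((2 * x + i).factorial : ℚ) * poch (3 * x + 2 * i + 2 : ℚ) i *
      poch (3 * x + 2 * i + 3 : ℚ) i /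
        (((x + 2 * i + 1).factorial : ℚ) * ((x + 2 * i + 2).factorial : ℚ)) : ℚ) : ℝ) := by
  have g1 := Real.Gamma_nat_eq_factorial (2 * x + i)
  have g2 := Real.Gamma_nat_eq_factorial (x + 2 * i + 1)
  have g3 := Real.Gamma_nat_eq_factorial (x + 2 * i + 2)
  push_cast at g1 g2 g3
  simp only [gammaFactor, poch]
  push_cast
  rw [← g1, ← g2, ← g3, div_eq_mul_inv, mul_inv, ← mul_assoc]
  ring_nf

/-- Corollary 6, case `m = 1`. -/
theorem cor6_m1 (x n : ℕ) (hn : 1 ≤ n) :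
    Edet x (x + 1) n =
      ((Nat.factorial n : ℚ) / (Nat.factorial (n / 2) : ℚ)) *
      (∏ i ∈ Finset.range n,
        ((Nat.factorial i : ℚ) * (Nat.factorial (2 * x + i) : ℚ) *
            poch (3 * x + 2 * i + 2 : ℚ) i * poch (3 * x + 2 * i + 3 : ℚ) i /
          ((Nat.factorial (x + 2 * i + 1) : ℚ) * (Nat.factorial (x + 2 * i + 2) : ℚ)))) *
      poch ((x : ℚ) + 1) (n / 2) := by
  rw [← Rat.cast_inj (α := ℝ), Edet_cast, gammaDet_self_add_one x.cast_nonneg,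
    egfPoly_self_add_one]
  simp only [gammaFactor_natCast]
  rw [Rat.cast_mul, Rat.cast_mul, Rat.cast_prod, poch]
  push_cast
  ring
end

section
/- For every nonnegative integer n there exists a polynomial P(X,Y) with rational coefficients of total degree n such that for all nonnegative integers x, y with x + y ≥ 1, E(x,y;n) = ∏_{i=0}^{n−1} [ (x+y+i−1)! · (2x+y+2i+1)_i · (x+2y+2i+1)_i / ((x+2i+1)! · (y+2i+1)!) ] · P(x,y). (Proposition 4) -/
open Finset

namespace Matrix

variable {R : Type*} [CommRing R]

theorem det_adjugate_toBlocks₁₁ {m n : Type*} [Fintype m] [Fintype n] [DecidableEq m]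
    [DecidableEq n] [Nonempty m] (A : Matrix (m ⊕ n) (m ⊕ n) R) :
    A.adjugate.toBlocks₁₁.det = A.det ^ (Fintype.card m - 1) * A.toBlocks₂₂.det := by
  let A' := mvPolynomialX (m ⊕ n) (m ⊕ n) ℤ
  suffices h : A'.adjugate.toBlocks₁₁.det =
      A'.det ^ (Fintype.card m - 1) * A'.toBlocks₂₂.det by
    let φ := MvPolynomial.aeval (R := ℤ) fun p : (m ⊕ n) × (m ⊕ n) => A p.1 p.2
    have e : φ.mapMatrix A' = A := mvPolynomialX_mapMatrix_aeval ℤ A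
    rw [← e, ← AlgHom.map_adjugate]
    change (φ.mapMatrix A'.adjugate.toBlocks₁₁).det = _ * (φ.mapMatrix A'.toBlocks₂₂).det
    rw [← AlgHom.map_det, ← AlgHom.map_det, ← AlgHom.map_det, ← map_pow, ← map_mul, h]
  have hdet : A'.det ≠ 0 := det_mvPolynomialX_ne_zero _ ℤ
  apply mul_left_cancel₀ hdet
  set C := A'.adjugate with hC
  have hmul : A' * fromBlocks C.toBlocks₁₁ 0 C.toBlocks₂₁ 1 =
      fromBlocks (A'.det • 1) A'.toBlocks₁₂ 0 A'.toBlocks₂₂ := by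
    have h := mul_adjugate A'
    rw [← hC] at h
    conv_lhs => rw [← fromBlocks_toBlocks A']
    rw [← fromBlocks_toBlocks A', ← fromBlocks_toBlocks C, fromBlocks_multiply,
      fromBlocks_toBlocks A', ← fromBlocks_one, fromBlocks_smul, fromBlocks_inj] at h
    rw [fromBlocks_multiply, h.1, h.2.2.1]
    simp
  have := congrArg det hmul
  rw [det_mul, det_fromBlocks_zero₁₂, det_fromBlocks_zero₂₁, det_one, mul_one, det_smul,
    det_one, mul_one] at this
  rw [this, ← mul_assoc, ← pow_succ', Nat.sub_add_cancel Fintype.card_pos]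

/-- The Desnanot–Jacobi identity. -/
theorem det_mul_det_submatrix_castSucc_succ {n : ℕ} (A : Matrix (Fin (n + 2)) (Fin (n + 2)) R) :
    A.det * (A.submatrix (fun i : Fin n => i.succ.castSucc) fun i => i.succ.castSucc).det =
      (A.submatrix Fin.castSucc Fin.castSucc).det * (A.submatrix Fin.succ Fin.succ).det -
        (A.submatrix Fin.succ Fin.castSucc).det * (A.submatrix Fin.castSucc Fin.succ).det := by
  let f : Fin 2 ⊕ Fin n → Fin (n + 2) :=
    Sum.elim ![0, Fin.last (n + 1)] fun i => i.succ.castSucc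
  have hf : Function.Bijective f := by
    rw [Fintype.bijective_iff_injective_and_card]
    refine ⟨?_, by simp [add_comm]⟩
    rintro (i | i) (j | j) h
    · fin_cases i <;> fin_cases j <;> simp_all [f, Fin.ext_iff]
    · have := j.isLt
      fin_cases i <;> simp [f, Fin.ext_iff] at h
      omega
    · have := i.isLt
      fin_cases j <;> simp [f, Fin.ext_iff] at h
      omega
    · simp only [f, Sum.elim_inr, Fin.ext_iff, Fin.val_castSucc, Fin.val_succ] at h
      exact congrArg _ (Fin.ext (by omega))
  have h := det_adjugate_toBlocks₁₁ (A.submatrix (Equiv.ofBijective f hf) (Equiv.ofBijective f hf))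
  rw [adjugate_submatrix_equiv_self, det_submatrix_equiv_self, det_fin_two] at h
  simp only [toBlocks₁₁, submatrix_apply, of_apply, Equiv.ofBijective_apply, f, Sum.elim_inl,
    adjugate_fin_succ_eq_det_submatrix, cons_val_zero, cons_val_one,
    Fin.succAbove_zero, Fin.succAbove_last, Fin.val_zero, Fin.val_last, Fintype.card_fin] at h
  have hs : ((-1 : R) ^ (n + 1)) ^ 2 = 1 := by rw [← pow_mul, mul_comm, pow_mul]; simp
  have h₂ : (A.submatrix (Equiv.ofBijective f hf) (Equiv.ofBijective f hf)).toBlocks₂₂ =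
      A.submatrix (fun i : Fin n => i.succ.castSucc) fun i => i.succ.castSucc := rfl
  simp only [f] at h₂
  rw [h₂] at h
  simp only [add_zero, zero_add, pow_zero, one_mul, pow_add _ (n + 1)] at h
  linear_combination -h + (A.submatrix Fin.castSucc Fin.castSucc).det *
    (A.submatrix Fin.succ Fin.succ).det * hs - 
        (A.submatrix Fin.succ Fin.castSucc).det * (A.submatrix Fin.castSucc Fin.succ).det * hs

end Matrix

section
variable {R : Type*} [CommRing R]

/-- The polynomials `∑ k, (-1)^k * n.choose k * (x)_k * (y)_{n-k}`, given by their recurrence. -/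
def altPoch (n : ℕ) (x y : R) : R :=
  match n with
  | 0 => 1
  | 1 => y - x
  | n + 2 => (y - x) * altPoch (n + 1) x y + (n + 1) * (n + x + y) * altPoch n x y

theorem altPoch_zero (x y : R) : altPoch 0 x y = 1 := by rw [altPoch]

theorem altPoch_one (x y : R) : altPoch 1 x y = y - x := by rw [altPoch]

theorem altPoch_add_two (n : ℕ) (x y : R) : altPoch (n + 2) x y =
    (y - x) * altPoch (n + 1) x y + (n + 1) * (n + x + y) * altPoch n x y := by
  rw [altPoch]

theorem altPoch_swap (n : ℕ) (x y : R) : altPoch n y x = (-1) ^ n * altPoch n x y := by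
  induction n using Nat.twoStepInduction with
  | zero => simp [altPoch_zero]
  | one => simp [altPoch_one]
  | more n h₁ h₂ => rw [altPoch_add_two, altPoch_add_two, h₁, h₂]; ring

theorem altPoch_succ_sub_one_left (n : ℕ) (x y : R) :
    altPoch (n + 1) (x - 1) y = altPoch (n + 1) x y + (n + 1) * altPoch n x y := by
  induction n using Nat.twoStepInduction with
  | zero => simp [altPoch_one, altPoch_zero]; ring
  | one => simp [altPoch_add_two, altPoch_one, altPoch_zero]; ring
  | more n h₁ h₂ =>
    rw [altPoch_add_two (n + 1), h₁, h₂, altPoch_add_two (n + 1), altPoch_add_two n]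
    push_cast
    ring

theorem altPoch_succ_sub_one_right (n : ℕ) (x y : R) :
    altPoch (n + 1) x (y - 1) = altPoch (n + 1) x y - (n + 1) * altPoch n x y := by
  rw [altPoch_swap, altPoch_succ_sub_one_left, altPoch_swap, altPoch_swap n x y]
  have hs : ((-1 : R) ^ n) ^ 2 = 1 := by rw [← pow_mul, mul_comm, pow_mul]; simp
  linear_combination (altPoch (n + 1) x y - (n + 1) * altPoch n x y) * hs

theorem altPoch_add_two_sub_one_sub_one (n : ℕ) (x y : R) :
    altPoch (n + 2) (x - 1) (y - 1) =
      altPoch (n + 2) x y - (n + 2) * (n + 1) * altPoch n x y := by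
  rw [altPoch_succ_sub_one_right (n + 1), altPoch_succ_sub_one_left (n + 1),
    altPoch_succ_sub_one_left n]
  push_cast
  ring

theorem altPoch_add_three_sub_three_left (n : ℕ) (x y : R) :
    altPoch (n + 3) (x - 3) y = altPoch (n + 3) x y + 3 * (n + 3) * altPoch (n + 2) x y +
      3 * (n + 3) * (n + 2) * altPoch (n + 1) x y +
      (n + 3) * (n + 2) * (n + 1) * altPoch n x y := by
  rw [show x - 3 = x - 1 - 1 - 1 by ring]
  repeat rw [altPoch_succ_sub_one_left (n + 2)]
  repeat rw [altPoch_succ_sub_one_left (n + 1)]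
  repeat rw [altPoch_succ_sub_one_left n]
  push_cast
  ring

theorem altPoch_add_three_sub_three_right (n : ℕ) (x y : R) :
    altPoch (n + 3) x (y - 3) = altPoch (n + 3) x y - 3 * (n + 3) * altPoch (n + 2) x y +
      3 * (n + 3) * (n + 2) * altPoch (n + 1) x y -
      (n + 3) * (n + 2) * (n + 1) * altPoch n x y := by
  rw [show y - 3 = y - 1 - 1 - 1 by ring]
  repeat rw [altPoch_succ_sub_one_right (n + 2)]
  repeat rw [altPoch_succ_sub_one_right (n + 1)]
  repeat rw [altPoch_succ_sub_one_right n]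
  push_cast
  ring

theorem altPoch_add_four_sub_two_sub_two (n : ℕ) (x y : R) :
    altPoch (n + 4) (x - 2) (y - 2) = altPoch (n + 4) x y -
      2 * (n + 4) * (n + 3) * altPoch (n + 2) x y +
      (n + 4) * (n + 3) * (n + 2) * (n + 1) * altPoch n x y := by
  rw [show x - 2 = x - 1 - 1 by ring, show y - 2 = y - 1 - 1 by ring,
    altPoch_add_two_sub_one_sub_one (n + 2), altPoch_add_two_sub_one_sub_one (n + 2),
    altPoch_add_two_sub_one_sub_one n]
  push_cast
  ring

theorem mul_altPoch_add_three_sub_two_sub_two (n : ℕ) (x y : R) :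
    (x + y + n - 1) * altPoch (n + 3) (x - 2) (y - 2) = (x + y + n - 1) *
        (altPoch (n + 3) x y - 2 * (n + 3) * (n + 2) * altPoch (n + 1) x y) +
      (n + 3) * (n + 2) * (n + 1) * (altPoch (n + 1) x y - (y - x) * altPoch n x y) := by
  cases n with
  | zero => simp [altPoch_add_two, altPoch_one, altPoch_zero]; ring
  | succ n =>
    rw [altPoch_add_four_sub_two_sub_two, altPoch_add_two n]
    push_cast
    ring

set_option maxRecDepth 10000 in
/-- The quadratic relation that `altPoch` has to satisfy for Dodgson condensation. -/
theorem altPoch_condensation_sub (n : ℕ) (x y : R) :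
    (n + 1) * (2 * x + y + 2 * n - 3) * (x + 2 * y + 2 * n - 3) *
        altPoch (n + 2) (x - 2) (y - 2) * altPoch n (x - 1) (y - 1) =
      (x + y + n - 3) * (x + 2 * n + 1) * (y + 2 * n + 1) *
        altPoch (n + 1) (x - 2) (y - 2) * altPoch (n + 1) (x - 1) (y - 1) -
      (x - 1) * (y - 1) * (x + y - 4) *
        altPoch (n + 1) x (y - 3) * altPoch (n + 1) (x - 3) y := by
  obtain _ | _ | m := n
  · simp [altPoch_add_two, altPoch_one, altPoch_zero]; ring
  · simp [altPoch_add_two, altPoch_one, altPoch_zero]; ring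
  · have h₁ := mul_altPoch_add_three_sub_two_sub_two m x y
    have h₂ := altPoch_add_two m x y
    have h₃ : altPoch (m + 3) x y = _ := altPoch_add_two (m + 1) x y
    have h₄ : altPoch (m + 4) x y = _ := altPoch_add_two (m + 2) x y
    change _ * altPoch (m + 4) (x - 2) (y - 2) * altPoch (m + 2) (x - 1) (y - 1) =
      _ * altPoch (m + 3) (x - 2) (y - 2) * altPoch (m + 3) (x - 1) (y - 1) -
        _ * altPoch (m + 3) x (y - 3) * altPoch (m + 3) (x - 3) y
    change altPoch (m + 3) x y = (y - x) * altPoch (m + 2) x y + _ at h₃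
    change altPoch (m + 4) x y = (y - x) * altPoch (m + 3) x y + _ at h₄
    rw [altPoch_add_four_sub_two_sub_two, altPoch_add_two_sub_one_sub_one m,
      altPoch_add_two_sub_one_sub_one (m + 1), altPoch_add_three_sub_three_left,
      altPoch_add_three_sub_three_right]
    change _ * _ * (altPoch (m + 2) x y - _) = _ * _ * (altPoch (m + 3) x y - _) - _
    push_cast at h₃ h₄ ⊢
    generalize altPoch (m + 3) (x - 2) (y - 2) = w at h₁ h₂ h₃ h₄ ⊢
    generalize altPoch (m + 4) x y = e at h₁ h₂ h₃ h₄ ⊢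
    generalize altPoch (m + 3) x y = d at h₁ h₂ h₃ h₄ ⊢
    generalize altPoch (m + 2) x y = c at h₁ h₂ h₃ h₄ ⊢
    generalize altPoch (m + 1) x y = b at h₁ h₂ h₃ h₄ ⊢
    generalize altPoch m x y = a at h₁ h₂ h₃ h₄ ⊢
    generalize (m : R) = k at h₁ h₂ h₃ h₄ ⊢
    rw [h₄, h₃, h₂]
    rw [h₃, h₂] at h₁
    linear_combination -(x + 2 * (k + 2) + 1) * (y + 2 * (k + 2) + 1) *
       ((y - x) * ((y - x) * b + (k + 1) * (k + x + y) * a) + (k + 1 + 1) * (k + 1 + x + y) * b -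
        (k + 3) * (k + 2) * b) * h₁
end

section

variable {R S : Type*} [CommRing R] [CommRing S]

theorem altPoch_condensation (n : ℕ) (x y : R) :
    (n + 1) * (2 * x + y + 2 * n + 3) * (x + 2 * y + 2 * n + 3) *
        altPoch (n + 2) x y * altPoch n (x + 1) (y + 1) =
      (x + y + n + 1) * (x + 2 * n + 3) * (y + 2 * n + 3) *
        altPoch (n + 1) x y * altPoch (n + 1) (x + 1) (y + 1) -
      (x + 1) * (y + 1) * (x + y) *
        altPoch (n + 1) (x + 2) (y - 1) * altPoch (n + 1) (x - 1) (y + 2) := by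
  have h := altPoch_condensation_sub n (x + 2) (y + 2)
  rw [show x + 2 - 2 = x by ring, show y + 2 - 2 = y by ring, show x + 2 - 1 = x + 1 by ring,
    show y + 2 - 1 = y + 1 by ring, show x + 2 - 3 = x - 1 by ring,
    show y + 2 - 3 = y - 1 by ring] at h
  linear_combination h

theorem map_altPoch (f : R →+* S) (n : ℕ) (x y : R) :
    f (altPoch n x y) = altPoch n (f x) (f y) := by
  induction n using Nat.twoStepInduction with
  | zero => simp [altPoch_zero]
  | one => simp [altPoch_one]
  | more n h₁ h₂ => simp [altPoch_add_two, h₁, h₂]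

/-- The Pochhammer symbol in a commutative ring. -/
def ringPoch (a : R) (k : ℕ) : R := ∏ i ∈ range k, (a + i)

theorem ringPoch_zero (a : R) : ringPoch a 0 = 1 := by simp [ringPoch]

theorem ringPoch_succ (a : R) (k : ℕ) : ringPoch a (k + 1) = ringPoch a k * (a + k) := by
  simp [ringPoch, prod_range_succ]

theorem ringPoch_succ' (a : R) (k : ℕ) : ringPoch a (k + 1) = a * ringPoch (a + 1) k := by
  rw [ringPoch, prod_range_succ', mul_comm, ringPoch]
  congr 1
  · simp
  · exact prod_congr rfl fun i _ => by push_cast; ring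

theorem map_ringPoch (f : R →+* S) (a : R) (k : ℕ) : f (ringPoch a k) = ringPoch (f a) k := by
  simp [ringPoch, map_prod]

theorem altPoch_zero_left (n : ℕ) (y : R) : altPoch n 0 y = ringPoch y n := by
  induction n using Nat.twoStepInduction with
  | zero => simp [altPoch_zero, ringPoch_zero]
  | one => simp [altPoch_one, ringPoch]
  | more n h₁ h₂ =>
    rw [altPoch_add_two, h₁, h₂, ringPoch_succ _ (n + 1), ringPoch_succ]
    push_cast
    ring

/-- The entries of the matrix of `Edet`, cleared of denominators. -/
def clearedEntry (x y : R) (i j : ℕ) : R :=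
  ringPoch (x + y + i) j * (y - x + 3 * j - 3 * i) * ringPoch (x + 2 * i - j + 2) j *
    ringPoch (y + 2 * j - i + 2) i

/-- The determinant `Edet`, cleared of denominators. -/
def clearedDet (n : ℕ) (x y : R) : R :=
  Matrix.det (Matrix.of fun i j : Fin n => clearedEntry x y i j)

/-- The product formula for `clearedDet`. -/
def clearedProd (n : ℕ) (x y : R) : R :=
  (∏ i ∈ range n, (i.factorial * ringPoch (2 * x + y + 2 * i + 1) i *
    ringPoch (x + 2 * y + 2 * i + 1) i)) * altPoch n x y

theorem map_clearedDet (f : R →+* S) (n : ℕ) (x y : R) :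
    f (clearedDet n x y) = clearedDet n (f x) (f y) := by
  rw [clearedDet, RingHom.map_det, clearedDet]
  congr 1
  ext i j
  simp [clearedEntry, map_ringPoch, map_ofNat f 2, map_ofNat f 3]

theorem map_clearedProd (f : R →+* S) (n : ℕ) (x y : R) :
    f (clearedProd n x y) = clearedProd n (f x) (f y) := by
  simp [clearedProd, map_ringPoch, map_altPoch, map_prod, map_ofNat f 2]

theorem clearedEntry_succ_succ (x y : R) (i j : ℕ) :
    clearedEntry x y (i + 1) (j + 1) =
      (x + y + i + 1) * (x + 2 * i + 3) * ((y + 2 * j + 3) *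
        clearedEntry (x + 1) (y + 1) i j) := by
  simp only [clearedEntry]
  rw [ringPoch_succ' _ j, ringPoch_succ _ j, ringPoch_succ _ i]
  push_cast
  rw [show x + y + (i + 1) + 1 = x + 1 + (y + 1) + (i : R) by ring,
    show x + 2 * (i + 1) - (j + 1) + 2 = x + 1 + 2 * i - j + (2 : R) by ring,
    show y + 2 * (j + 1) - (i + 1) + 2 = y + 1 + 2 * j - i + (2 : R) by ring]
  ring

theorem clearedEntry_succ_left (x y : R) (i j : ℕ) :
    clearedEntry x y (i + 1) j = (y + 2 * j + 1) * clearedEntry (x + 2) (y - 1) i j := by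
  simp only [clearedEntry]
  rw [ringPoch_succ _ i]
  push_cast
  rw [show x + y + (i + 1) = x + 2 + (y - 1) + (i : R) by ring,
    show x + 2 * (i + 1) - j + 2 = x + 2 + 2 * i - j + (2 : R) by ring,
    show y + 2 * j - (i + 1) + 2 = y - 1 + 2 * j - i + (2 : R) by ring]
  ring

theorem clearedEntry_succ_right (x y : R) (i j : ℕ) :
    clearedEntry x y i (j + 1) =
      (x + y + i) * (x + 2 * i + 1) * clearedEntry (x - 1) (y + 2) i j := by
  simp only [clearedEntry]
  rw [ringPoch_succ' _ j, ringPoch_succ _ j]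
  push_cast
  rw [show x + y + i + 1 = x - 1 + (y + 2) + (i : R) by ring,
    show x + 2 * i - (j + 1) + 2 = x - 1 + 2 * i - j + (2 : R) by ring,
    show y + 2 * (j + 1) - i + 2 = y + 2 + 2 * j - i + (2 : R) by ring]
  ring

theorem det_clearedEntry_succ_succ (n : ℕ) (x y : R) :
    Matrix.det (Matrix.of fun i j : Fin n => clearedEntry x y (i + 1) (j + 1)) =
      (∏ i ∈ range n, (x + y + i + 1) * (x + 2 * i + 3) * (y + 2 * i + 3)) *
        clearedDet n (x + 1) (y + 1) := by
  have h := Matrix.det_mul_row (fun j : Fin n => y + 2 * ((j : ℕ) : R) + 3)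
    (Matrix.of fun i j : Fin n => clearedEntry (x + 1) (y + 1) i j)
  have h' := Matrix.det_mul_column
    (fun i : Fin n => (x + y + ((i : ℕ) : R) + 1) * (x + 2 * ((i : ℕ) : R) + 3))
    (Matrix.of fun i j : Fin n => (y + 2 * ((j : ℕ) : R) + 3) *
      clearedEntry (x + 1) (y + 1) i j)
  simp only [Matrix.of_apply, ← clearedEntry_succ_succ] at h h'
  rw [h', h, ← clearedDet, ← mul_assoc, ← prod_mul_distrib, ← Fin.prod_univ_eq_prod_range
    (fun i => (x + y + (i : R) + 1) * (x + 2 * (i : R) + 3) * (y + 2 * (i : R) + 3))]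

theorem det_clearedEntry_succ_left (n : ℕ) (x y : R) :
    Matrix.det (Matrix.of fun i j : Fin n => clearedEntry x y (i + 1) j) =
      (∏ i ∈ range n, (y + 2 * i + 1)) * clearedDet n (x + 2) (y - 1) := by
  have h := Matrix.det_mul_row (fun j : Fin n => y + 2 * ((j : ℕ) : R) + 1)
    (Matrix.of fun i j : Fin n => clearedEntry (x + 2) (y - 1) i j)
  simp only [Matrix.of_apply, ← clearedEntry_succ_left] at h
  rw [h, ← clearedDet, ← Fin.prod_univ_eq_prod_range (fun i => y + 2 * (i : R) + 1)]

theorem det_clearedEntry_succ_right (n : ℕ) (x y : R) :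
    Matrix.det (Matrix.of fun i j : Fin n => clearedEntry x y i (j + 1)) =
      (∏ i ∈ range n, (x + y + i) * (x + 2 * i + 1)) * clearedDet n (x - 1) (y + 2) := by
  have h := Matrix.det_mul_column
    (fun i : Fin n => (x + y + ((i : ℕ) : R)) * (x + 2 * ((i : ℕ) : R) + 1))
    (Matrix.of fun i j : Fin n => clearedEntry (x - 1) (y + 2) i j)
  simp only [Matrix.of_apply, ← clearedEntry_succ_right] at h
  rw [h, ← clearedDet,
    ← Fin.prod_univ_eq_prod_range (fun i => (x + y + (i : R)) * (x + 2 * (i : R) + 1))]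

/-- The factor split off the central minor of the matrix of `clearedDet`. -/
def minorFactor (n : ℕ) (x y : R) : R :=
  ∏ i ∈ range n, (x + y + i + 1) * (x + 2 * i + 3) * (y + 2 * i + 3)

theorem map_minorFactor (f : R →+* S) (n : ℕ) (x y : R) :
    f (minorFactor n x y) = minorFactor n (f x) (f y) := by
  simp [minorFactor, map_prod, map_ofNat f 2, map_ofNat f 3]

theorem minorFactor_succ (n : ℕ) (x y : R) : minorFactor (n + 1) x y =
    minorFactor n x y * ((x + y + n + 1) * (x + 2 * n + 3) * (y + 2 * n + 3)) := by
  rw [minorFactor, prod_range_succ, minorFactor]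

theorem prod_mul_prod_eq_minorFactor (n : ℕ) (x y : R) :
    (∏ i ∈ range (n + 1), (y + 2 * i + 1)) *
        (∏ i ∈ range (n + 1), (x + y + i) * (x + 2 * i + 1)) =
      minorFactor n x y * ((x + y) * (x + 1) * (y + 1)) := by
  rw [prod_range_succ', prod_range_succ', minorFactor, mul_mul_mul_comm, ← prod_mul_distrib]
  congr 1
  · refine prod_congr rfl fun i _ => ?_
    push_cast
    ring
  · push_cast
    ring

theorem clearedDet_condensation (n : ℕ) (x y : R) :
    clearedDet (n + 2) x y * (minorFactor n x y * clearedDet n (x + 1) (y + 1)) =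
      minorFactor n x y *
        ((x + y + n + 1) * (x + 2 * n + 3) * (y + 2 * n + 3) *
            clearedDet (n + 1) x y * clearedDet (n + 1) (x + 1) (y + 1) -
          (x + y) * (x + 1) * (y + 1) *
            clearedDet (n + 1) (x + 2) (y - 1) * clearedDet (n + 1) (x - 1) (y + 2)) := by
  have h := Matrix.det_mul_det_submatrix_castSucc_succ
    (Matrix.of fun i j : Fin (n + 2) => clearedEntry x y i j)
  change clearedDet (n + 2) x y * Matrix.det (Matrix.of fun i j : Fin n =>
      clearedEntry x y (i + 1) (j + 1)) =
    clearedDet (n + 1) x y * Matrix.det (Matrix.of fun i j : Fin (n + 1) =>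
      clearedEntry x y (i + 1) (j + 1)) -
    Matrix.det (Matrix.of fun i j : Fin (n + 1) => clearedEntry x y (i + 1) j) *
    Matrix.det (Matrix.of fun i j : Fin (n + 1) => clearedEntry x y i (j + 1)) at h
  rw [det_clearedEntry_succ_succ, det_clearedEntry_succ_succ, det_clearedEntry_succ_left,
    det_clearedEntry_succ_right, ← minorFactor, ← minorFactor, minorFactor_succ] at h
  linear_combination h - clearedDet (n + 1) (x + 2) (y - 1) *
    clearedDet (n + 1) (x - 1) (y + 2) * prod_mul_prod_eq_minorFactor n x y

theorem prod_ringPoch_condensation (n : ℕ) (z : R) :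
    (∏ i ∈ range (n + 2), ringPoch (z + 2 * i + 1) i) *
        ∏ i ∈ range n, ringPoch (z + 3 + 2 * i + 1) i =
      (z + 2 * n + 3) * (∏ i ∈ range (n + 1), ringPoch (z + 2 * i + 1) i) *
        ∏ i ∈ range (n + 1), ringPoch (z + 3 + 2 * i + 1) i := by
  rw [prod_range_succ _ (n + 1), prod_range_succ (fun i : ℕ => ringPoch (z + 3 + 2 * i + 1) i) n,
    ringPoch_succ']
  push_cast
  rw [show z + 2 * ((n : R) + 1) + 1 + 1 = z + 3 + 2 * n + 1 by ring]
  ring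

theorem clearedProd_condensation (n : ℕ) (x y : R) :
    clearedProd (n + 2) x y * clearedProd n (x + 1) (y + 1) =
      (x + y + n + 1) * (x + 2 * n + 3) * (y + 2 * n + 3) *
          clearedProd (n + 1) x y * clearedProd (n + 1) (x + 1) (y + 1) -
        (x + y) * (x + 1) * (y + 1) *
          clearedProd (n + 1) (x + 2) (y - 1) * clearedProd (n + 1) (x - 1) (y + 2) := by
  have hz := prod_ringPoch_condensation n (2 * x + y)
  have hw := prod_ringPoch_condensation n (x + 2 * y)
  have hf : (∏ i ∈ range (n + 2), (i.factorial : R)) * ∏ i ∈ range n, (i.factorial : R) =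
      (n + 1) * (∏ i ∈ range (n + 1), (i.factorial : R)) ^ 2 := by
    rw [prod_range_succ _ (n + 1), prod_range_succ _ n, Nat.factorial_succ]
    push_cast
    ring
  have ha := altPoch_condensation n x y
  simp only [clearedProd, prod_mul_distrib]
  rw [show 2 * (x + 1) + (y + 1) = 2 * x + y + 3 by ring,
    show (x + 1) + 2 * (y + 1) = x + 2 * y + 3 by ring,
    show 2 * (x + 2) + (y - 1) = 2 * x + y + 3 by ring,
    show (x + 2) + 2 * (y - 1) = x + 2 * y by ring,
    show 2 * (x - 1) + (y + 2) = 2 * x + y by ring,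
    show (x - 1) + 2 * (y + 2) = x + 2 * y + 3 by ring]
  generalize ∏ i ∈ range (n + 2), ringPoch (2 * x + y + 2 * i + 1) i = a₂ at *
  generalize ∏ i ∈ range (n + 1), ringPoch (2 * x + y + 2 * i + 1) i = a₁ at *
  generalize ∏ i ∈ range (n + 1), ringPoch (2 * x + y + 3 + 2 * i + 1) i = a₁' at *
  generalize ∏ i ∈ range n, ringPoch (2 * x + y + 3 + 2 * i + 1) i = a₀' at *
  generalize ∏ i ∈ range (n + 2), ringPoch (x + 2 * y + 2 * i + 1) i = b₂ at *
  generalize ∏ i ∈ range (n + 1), ringPoch (x + 2 * y + 2 * i + 1) i = b₁ at *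
  generalize ∏ i ∈ range (n + 1), ringPoch (x + 2 * y + 3 + 2 * i + 1) i = b₁' at *
  generalize ∏ i ∈ range n, ringPoch (x + 2 * y + 3 + 2 * i + 1) i = b₀' at *
  generalize ∏ i ∈ range (n + 2), (i.factorial : R) = f₂ at *
  generalize ∏ i ∈ range (n + 1), (i.factorial : R) = f₁ at *
  generalize ∏ i ∈ range n, (i.factorial : R) = f₀ at *
  calc _ = (f₂ * f₀) * (a₂ * a₀') * (b₂ * b₀') *
        (altPoch (n + 2) x y * altPoch n (x + 1) (y + 1)) := by ring
    _ = _ := by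
      rw [hf, hz, hw]
      linear_combination f₁ ^ 2 * a₁ * a₁' * b₁ * b₁' * ha

end

theorem minorFactor_mul_clearedProd_ne_zero (n : ℕ) (a b : ℚ) :
    minorFactor n (MvPolynomial.X 0 + MvPolynomial.C a : MvPolynomial (Fin 2) ℚ)
        (MvPolynomial.X 1 + MvPolynomial.C b) *
      clearedProd n (MvPolynomial.X 0 + MvPolynomial.C a + 1)
        (MvPolynomial.X 1 + MvPolynomial.C b + 1) ≠ 0 := by
  intro h
  have h' := congrArg (MvPolynomial.eval ![-1 - a, 1 - b]) h
  rw [map_mul, map_minorFactor, map_clearedProd] at h'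
  simp only [map_add, MvPolynomial.eval_X, MvPolynomial.eval_C, Matrix.cons_val_zero,
    Matrix.cons_val_one, sub_add_cancel, map_one, map_zero] at h'
  refine h'.not_gt (mul_pos (prod_pos fun i _ => ?_) (mul_pos (prod_pos fun i _ => ?_) ?_))
  · rw [show (-1 + 1 + (i : ℚ) + 1) * (-1 + 2 * i + 3) * (1 + 2 * i + 3) =
      (i + 1) * (2 * i + 2) * (2 * i + 4) by ring]
    positivity
  · rw [show (-1 + 1 : ℚ) = 0 by norm_num]
    exact mul_pos (mul_pos (by positivity) (prod_pos fun _ _ => by positivity))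
      (prod_pos fun _ _ => by positivity)
  · rw [show (-1 + 1 : ℚ) = 0 by norm_num, altPoch_zero_left]
    exact prod_pos fun _ _ => by positivity

theorem clearedDet_X_add_C (n : ℕ) (a b : ℚ) :
    clearedDet n (MvPolynomial.X 0 + MvPolynomial.C a : MvPolynomial (Fin 2) ℚ)
        (MvPolynomial.X 1 + MvPolynomial.C b) =
      clearedProd n (MvPolynomial.X 0 + MvPolynomial.C a)
        (MvPolynomial.X 1 + MvPolynomial.C b) := by
  induction n using Nat.twoStepInduction generalizing a b with
  | zero => simp [clearedDet, clearedProd, altPoch_zero]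
  | one => simp [clearedDet, clearedProd, altPoch_one, clearedEntry, ringPoch_zero]
  | more n h₁ h₂ =>
    have hne := minorFactor_mul_clearedProd_ne_zero n a b
    refine mul_right_cancel₀ hne ?_
    have hD := clearedDet_condensation n
      (MvPolynomial.X 0 + MvPolynomial.C a : MvPolynomial (Fin 2) ℚ)
      (MvPolynomial.X 1 + MvPolynomial.C b)
    have hP := clearedProd_condensation n
      (MvPolynomial.X 0 + MvPolynomial.C a : MvPolynomial (Fin 2) ℚ)
      (MvPolynomial.X 1 + MvPolynomial.C b)
    have s₁ (i : Fin 2) (c : ℚ) : (MvPolynomial.X i + MvPolynomial.C (c + 1) :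
        MvPolynomial (Fin 2) ℚ) = MvPolynomial.X i + MvPolynomial.C c + 1 := by
      rw [map_add, map_one, add_assoc]
    have s₂ (i : Fin 2) (c : ℚ) : (MvPolynomial.X i + MvPolynomial.C (c + 2) :
        MvPolynomial (Fin 2) ℚ) = MvPolynomial.X i + MvPolynomial.C c + 2 := by
      rw [map_add, map_ofNat _ 2, add_assoc]
    have s₃ (i : Fin 2) (c : ℚ) : (MvPolynomial.X i + MvPolynomial.C (c - 1) :
        MvPolynomial (Fin 2) ℚ) = MvPolynomial.X i + MvPolynomial.C c - 1 := by
      rw [map_sub, map_one, add_sub_assoc]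
    have e₀ := h₁ (a + 1) (b + 1)
    have e₁ := h₂ (a + 1) (b + 1)
    have e₂ := h₂ (a + 2) (b - 1)
    have e₃ := h₂ (a - 1) (b + 2)
    simp only [s₁, s₂, s₃] at e₀ e₁ e₂ e₃
    rw [e₀, e₁, e₂, e₃, h₂ a b] at hD
    rw [hD, ← hP]
    ring

theorem clearedDet_eq_clearedProd (n : ℕ) (x y : ℚ) : clearedDet n x y = clearedProd n x y := by
  have h := congrArg (MvPolynomial.eval ![x, y]) (clearedDet_X_add_C n 0 0)
  rw [map_clearedDet, map_clearedProd] at h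
  simpa using h

theorem rfacInv_eq_mul_add_one (m : ℤ) : rfacInv m = rfacInv (m + 1) * (m + 1) := by
  rcases lt_trichotomy m (-1) with h | rfl | h
  · rw [rfacInv, rfacInv, if_neg (by omega), if_neg (by omega), zero_mul]
  · simp [rfacInv]
  · lift m to ℕ using by omega
    rw [rfacInv, rfacInv, if_pos (by omega), if_pos (by omega),
      show ((m : ℤ) + 1).toNat = m + 1 by omega, Int.toNat_natCast, Nat.factorial_succ]
    have : (m.factorial : ℚ) ≠ 0 := by positivity
    push_cast
    field_simp

theorem rfacInv_eq_mul_ringPoch (m : ℤ) (k : ℕ) :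
    rfacInv m = rfacInv (m + k) * ringPoch (m + 1 : ℚ) k := by
  induction k with
  | zero => simp [ringPoch_zero]
  | succ k ih =>
    rw [ih, rfacInv_eq_mul_add_one (m + k), ringPoch_succ]
    push_cast
    rw [show m + (k : ℤ) + 1 = m + (k + 1) by ring]
    ring

theorem rfac_add (N k : ℕ) : rfac (N + k) = N.factorial * ringPoch (N + 1 : ℚ) k := by
  induction k with
  | zero => simp [rfac, ringPoch_zero]
  | succ k ih =>
    rw [ringPoch_succ, ← mul_assoc, ← ih, rfac, rfac, if_pos (by positivity),
      if_pos (by positivity), show ((N : ℤ) + (k + 1 : ℕ)).toNat = N + k + 1 by omega,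
      show ((N : ℤ) + k).toNat = N + k by omega, Nat.factorial_succ]
    push_cast
    ring

theorem rfacInv_natCast (k : ℕ) : rfacInv k = (k.factorial : ℚ)⁻¹ := by simp [rfacInv]

theorem Edet_eq (x y n : ℕ) (h : 1 ≤ x + y) : Edet x y n =
    (∏ i ∈ range n, ((x + y + i - 1).factorial : ℚ) /
      (((x + 2 * i + 1).factorial : ℚ) * ((y + 2 * i + 1).factorial : ℚ))) *
      clearedDet n (x : ℚ) y := by
  have hr := Matrix.det_mul_row (fun j : Fin n => ((y + 2 * (j : ℕ) + 1).factorial : ℚ)⁻¹)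
    (Matrix.of fun i j : Fin n => clearedEntry (x : ℚ) y i j)
  have hc := Matrix.det_mul_column (fun i : Fin n => ((x + y + (i : ℕ) - 1).factorial : ℚ) *
    ((x + 2 * (i : ℕ) + 1).factorial : ℚ)⁻¹) (Matrix.of fun i j : Fin n =>
      ((y + 2 * (j : ℕ) + 1).factorial : ℚ)⁻¹ * clearedEntry (x : ℚ) y i j)
  simp only [Matrix.of_apply] at hr hc
  rw [hr, ← mul_assoc, ← prod_mul_distrib, ← clearedDet, Fin.prod_univ_eq_prod_range
    (fun i => ((x + y + i - 1).factorial : ℚ) * ((x + 2 * i + 1).factorial : ℚ)⁻¹ *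
      ((y + 2 * i + 1).factorial : ℚ)⁻¹)] at hc
  simp only [div_eq_mul_inv, mul_inv, ← mul_assoc]
  rw [← hc, Edet]
  congr 1
  ext i j
  obtain ⟨i, -⟩ := i
  obtain ⟨j, -⟩ := j
  obtain ⟨N, hN⟩ : ∃ N, x + y + i = N + 1 := ⟨x + y + i - 1, by omega⟩
  have hN' : (x : ℚ) + y + i = N + 1 := by exact_mod_cast hN
  simp only [Matrix.of_apply]
  rw [show (x : ℤ) + y + i + j - 1 = N + j by omega, rfac_add,
    rfacInv_eq_mul_ringPoch (x + 2 * i - j + 1) j,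
    rfacInv_eq_mul_ringPoch (y + 2 * j - i + 1) i,
    show (x : ℤ) + 2 * i - j + 1 + j = (x + 2 * i + 1 : ℕ) by push_cast; ring,
    show (y : ℤ) + 2 * j - i + 1 + i = (y + 2 * j + 1 : ℕ) by push_cast; ring,
    rfacInv_natCast, rfacInv_natCast, hN, Nat.add_sub_cancel, clearedEntry, hN']
  push_cast
  rw [show (x : ℚ) + 2 * i - j + 1 + 1 = x + 2 * i - j + 2 by ring,
    show (y : ℚ) + 2 * j - i + 1 + 1 = y + 2 * j - i + 2 by ring]
  ring

theorem totalDegree_altPoch_le (n : ℕ) :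
    (altPoch n (MvPolynomial.X 0) (MvPolynomial.X 1 : MvPolynomial (Fin 2) ℚ)).totalDegree ≤
      n := by
  have hX (i : Fin 2) : (MvPolynomial.X i : MvPolynomial (Fin 2) ℚ).totalDegree ≤ 1 := by simp
  have hs : (MvPolynomial.X 1 - MvPolynomial.X 0 : MvPolynomial (Fin 2) ℚ).totalDegree ≤ 1 :=
    (MvPolynomial.totalDegree_sub _ _).trans (max_le (hX _) (hX _))
  induction n using Nat.twoStepInduction with
  | zero => simp [altPoch_zero]
  | one => rwa [altPoch_one]
  | more n h₁ h₂ =>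
    rw [altPoch_add_two]
    refine (MvPolynomial.totalDegree_add _ _).trans (max_le ?_ ?_)
    · exact (MvPolynomial.totalDegree_mul _ _).trans (by omega)
    · have hc (m : ℕ) : (m : MvPolynomial (Fin 2) ℚ).totalDegree = 0 := by
        rw [← map_natCast MvPolynomial.C]
        exact MvPolynomial.totalDegree_C _
      have hn : ((n : MvPolynomial (Fin 2) ℚ) + 1).totalDegree = 0 := by
        exact_mod_cast hc (n + 1)
      have hl : ((n : MvPolynomial (Fin 2) ℚ) + MvPolynomial.X 0 +
          MvPolynomial.X 1).totalDegree ≤ 1 :=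
        (MvPolynomial.totalDegree_add _ _).trans (max_le ((MvPolynomial.totalDegree_add _ _).trans
          (max_le ((hc n).trans_le zero_le_one) (hX _))) (hX _))
      refine (MvPolynomial.totalDegree_mul _ _).trans ?_
      have := MvPolynomial.totalDegree_mul ((n : MvPolynomial (Fin 2) ℚ) + 1)
        ((n : MvPolynomial (Fin 2) ℚ) + MvPolynomial.X 0 + MvPolynomial.X 1)
      omega

theorem le_totalDegree_C_mul_altPoch (n : ℕ) {c : ℚ} (hc : c ≠ 0) :
    n ≤ (MvPolynomial.C c * altPoch n (MvPolynomial.X 0)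
      (MvPolynomial.X 1 : MvPolynomial (Fin 2) ℚ)).totalDegree := by
  have h := MvPolynomial.aeval_natDegree_le (n := 1) (MvPolynomial.C c *
    altPoch n (MvPolynomial.X 0) (MvPolynomial.X 1 : MvPolynomial (Fin 2) ℚ)) le_rfl
    ![0, Polynomial.X] fun i => by fin_cases i <;> simp
  have e : MvPolynomial.aeval ![0, Polynomial.X] (MvPolynomial.C c *
      altPoch n (MvPolynomial.X 0) (MvPolynomial.X 1 : MvPolynomial (Fin 2) ℚ)) =
      Polynomial.C c * ringPoch (Polynomial.X : Polynomial ℚ) n := by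
    rw [map_mul, ← AlgHom.coe_toRingHom, map_altPoch]
    simp [altPoch_zero_left, Polynomial.C_eq_algebraMap]
  rw [e, Polynomial.natDegree_C_mul hc, ringPoch, Polynomial.natDegree_prod_of_monic, mul_one] at h
  · refine le_trans (le_of_eq ?_) h
    have (i : ℕ) : ((Polynomial.X : Polynomial ℚ) + (i : Polynomial ℚ)).natDegree = 1 := by
      rw [← Polynomial.C_eq_natCast, Polynomial.natDegree_X_add_C]
    simp [this]
  · intro i _
    rw [← Polynomial.C_eq_natCast]
    exact Polynomial.monic_X_add_C _

/-- Proposition 4: existence of a polynomial factor `P(x,y)` of total degree `n`. -/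
theorem prop4 (n : ℕ) :
    ∃ P : MvPolynomial (Fin 2) ℚ, P.totalDegree = n ∧
      ∀ x y : ℕ, 1 ≤ x + y →
        Edet x y n =
          (∏ i ∈ Finset.range n,
            ((Nat.factorial (x + y + i - 1) : ℚ) *
                poch (2 * x + y + 2 * i + 1 : ℚ) i * poch (x + 2 * y + 2 * i + 1 : ℚ) i /
              ((Nat.factorial (x + 2 * i + 1) : ℚ) * (Nat.factorial (y + 2 * i + 1) : ℚ)))) *
          MvPolynomial.eval ![(x : ℚ), (y : ℚ)] P := by
  have hc : (∏ i ∈ range n, (i.factorial : ℚ)) ≠ 0 := prod_ne_zero_iff.2 fun i _ => by positivity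
  refine ⟨MvPolynomial.C (∏ i ∈ range n, (i.factorial : ℚ)) *
    altPoch n (MvPolynomial.X 0) (MvPolynomial.X 1), le_antisymm ?_
      (le_totalDegree_C_mul_altPoch n hc), fun x y h => ?_⟩
  · refine (MvPolynomial.totalDegree_mul _ _).trans ?_
    rw [MvPolynomial.totalDegree_C, zero_add]
    exact totalDegree_altPoch_le n
  · rw [Edet_eq x y n h, clearedDet_eq_clearedProd, clearedProd, map_mul, map_altPoch]
    simp only [MvPolynomial.eval_C, MvPolynomial.eval_X, Matrix.cons_val_zero, Matrix.cons_val_one]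
    rw [← mul_assoc, ← mul_assoc, ← prod_mul_distrib, ← prod_mul_distrib]
    congr 1
    refine prod_congr rfl fun i _ => ?_
    change _ = _ * ringPoch _ _ * ringPoch _ _ / _ * _
    ring
end
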